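/- arXiv:1109.0251 — 10 statements merged into one kernel-verified Lean document; each statement's English description precedes it below -/
import Mathlib

section
/- Let x·y be a post-Lie algebra structure on a pair of Lie algebras (g,n). Then for all x,y,z ∈ V the following identities hold: (1) {x,y}·z = (y·x)·z − y·(x·z) − (x·y)·z + x·(y·z); (2) [x·y, z] + [y, x·z] − x·[y,z] = (x·y)·z − (x·z)·y + y·(x·z) − x·(y·z) + x·(z·y) − z·(x·y); (3) x·{y,z} + y·{z,x} + z·{x,y} = {[x,y],z} + {[y,z],x} + {[z,x],y}; (4) {x,y}·z + {y,z}·x + {z,x}·y = {[x,y],z} + {[y,z],x} + {[z,x],y} + [{x,y},z] + [{y,z},x] + [{z,x},y]. -/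
/-- `B` is a Lie bracket on `V`: it is antisymmetric and satisfies the Jacobi identity. -/
def IsLieBracketOp {k V : Type*} [Field k] [AddCommGroup V] [Module k V]
    (B : V →ₗ[k] V →ₗ[k] V) : Prop :=
  (∀ x y : V, B x y + B y x = 0) ∧
  (∀ x y z : V, B (B x y) z + B (B y z) x + B (B z x) y = 0)

/-- A post-Lie algebra structure on the pair of Lie algebras `(g, n)`, where `g` has
bracket `bg` and `n` has bracket `bn`, both on the same underlying vector space `V`. -/
def IsPostLieStructure {k V : Type*} [Field k] [AddCommGroup V] [Module k V]
    (mul bg bn : V →ₗ[k] V →ₗ[k] V) : Prop :=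
  (∀ x y : V, mul x y - mul y x = bg x y - bn x y) ∧
  (∀ x y z : V, mul (bg x y) z = mul x (mul y z) - mul y (mul x z)) ∧
  (∀ x y z : V, mul x (bn y z) = bn (mul x y) z + bn y (mul x z))

/-- Lemma 2.6: consequences of the post-Lie structure axioms. -/
theorem postLieStructure_identities {k V : Type*} [Field k] [CharZero k]
    [AddCommGroup V] [Module k V] [FiniteDimensional k V]
    (mul bg bn : V →ₗ[k] V →ₗ[k] V)
    (hbg : IsLieBracketOp bg) (hbn : IsLieBracketOp bn)
    (h : IsPostLieStructure mul bg bn) :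
    (∀ x y z : V, mul (bn x y) z =
        mul (mul y x) z - mul y (mul x z) - mul (mul x y) z + mul x (mul y z)) ∧
    (∀ x y z : V, bg (mul x y) z + bg y (mul x z) - mul x (bg y z) =
        mul (mul x y) z - mul (mul x z) y + mul y (mul x z) - mul x (mul y z)
          + mul x (mul z y) - mul z (mul x y)) ∧
    (∀ x y z : V, mul x (bn y z) + mul y (bn z x) + mul z (bn x y) =
        bn (bg x y) z + bn (bg y z) x + bn (bg z x) y) ∧
    (∀ x y z : V, mul (bn x y) z + mul (bn y z) x + mul (bn z x) y =
        bn (bg x y) z + bn (bg y z) x + bn (bg z x) y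
          + bg (bn x y) z + bg (bn y z) x + bg (bn z x) y) := by
  obtain ⟨h1, h2, h3⟩ := h
  have hmul : ∀ x y : V, bn x y = bg x y - mul x y + mul y x := fun x y => by
    rw [sub_add, h1 x y]; abel
  have hbr : ∀ x y : V, bg x y = mul x y - mul y x + bn x y := fun x y => by
    rw [h1 x y]; abel
  have cyclic : ∀ x y z : V, mul x (bn y z) + mul y (bn z x) + mul z (bn x y) =
      bn (bg x y) z + bn (bg y z) x + bn (bg z x) y := fun x y z => by
    have swap : ∀ u v : V, bn u v = -bn v u := fun u v => eq_neg_of_add_eq_zero_left (hbn.1 u v)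
    rw [h3 x y z, h3 y z x, h3 z x y, hbr x y, hbr y z, hbr z x,
      swap y (mul x z), swap z (mul y x), swap x (mul z y)]
    simp only [map_add, map_sub, LinearMap.add_apply, LinearMap.sub_apply]
    rw [← sub_eq_zero, ← neg_eq_zero, ← hbn.2 x y z]
    abel
  refine ⟨fun x y z => ?_, fun x y z => ?_, cyclic, fun x y z => ?_⟩
  · rw [hmul x y]
    simp only [map_add, map_sub, LinearMap.add_apply, LinearMap.sub_apply, h2]
    abel
  · rw [hbr (mul x y) z, hbr y (mul x z), hbr y z]
    simp only [map_add, map_sub, h3]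
    abel
  · rw [← cyclic x y z, hbr (bn x y) z, hbr (bn y z) x, hbr (bn z x) y,
      ← sub_eq_zero, ← neg_eq_zero, ← hbn.2 x y z]
    abel
end

section
/- Let (g,n) be a pair of Lie algebras on a vector space V with g abelian (i.e. [x,y] = 0 for all x,y ∈ V). Then a bilinear product x·y on V is a post-Lie algebra structure on (g,n) if and only if the product x∘y := −x·y is an LR-structure on n, i.e. x∘y − y∘x = {x,y}, x∘(y∘z) = y∘(x∘z), and (x∘y)∘z = (x∘z)∘y for all x,y,z ∈ V. -/
/-- `o` is an LR-structure on the Lie algebra `n` with bracket `bn`. -/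
def IsLRStructure {k V : Type*} [Field k] [AddCommGroup V] [Module k V]
    (bn : V →ₗ[k] V →ₗ[k] V) (o : V → V → V) : Prop :=
  (∀ x y : V, o x y - o y x = bn x y) ∧
  (∀ x y z : V, o x (o y z) = o y (o x z)) ∧
  (∀ x y z : V, o (o x y) z = o (o x z) y)

/-- If `g` is abelian, a bilinear product `mul` is a post-Lie algebra structure on `(g,n)`
if and only if `x ∘ y := -(x·y)` is an LR-structure on `n`. -/
theorem isPostLieStructure_iff_LR {k V : Type*} [Field k] [CharZero k]
    [AddCommGroup V] [Module k V] [FiniteDimensional k V]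
    (mul bg bn : V →ₗ[k] V →ₗ[k] V)
    (hbg : IsLieBracketOp bg) (hbn : IsLieBracketOp bn)
    (habelian : ∀ x y : V, bg x y = 0) :
    IsPostLieStructure mul bg bn ↔ IsLRStructure bn (fun x y => -(mul x y)) := by
  simp only [IsPostLieStructure, IsLRStructure, habelian, map_zero, map_neg,
    LinearMap.zero_apply, LinearMap.neg_apply, neg_neg]
  constructor
  · rintro ⟨hcomm, hleft, hder⟩
    have hbracket : ∀ x y, bn x y = mul y x - mul x y := fun x y => by
      rw [← neg_sub, hcomm, zero_sub, neg_neg]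
    have hleft' : ∀ x y z, mul x (mul y z) = mul y (mul x z) := fun x y z =>
      sub_eq_zero.mp (hleft x y z).symm
    refine ⟨fun x y => by rw [hbracket]; abel, hleft', fun x y z => ?_⟩
    have h := hder x y z
    simp only [hbracket, map_sub] at h
    rw [hleft' x z y, hleft' x y z] at h
    rw [← sub_eq_zero] at h ⊢
    rw [← h]
    abel
  · rintro ⟨hcomm, hleft, hright⟩
    have hbracket : ∀ x y, bn x y = mul y x - mul x y := fun x y => by
      rw [← hcomm]; abel
    refine ⟨fun x y => by rw [hbracket]; abel, fun x y z => by rw [hleft, sub_self],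
      fun x y z => ?_⟩
    simp only [hbracket, map_sub]
    rw [hleft x z y, hleft x y z, hright x y z]
    abel
end

section
/- Let x·y be a post-Lie algebra structure on a pair of Lie algebras (g,n), where n is complete, i.e. every derivation of n is an inner derivation ad(a) = {a,·} for some a ∈ n, and the center of n is trivial. Then there exists a unique linear map φ: V → V such that x·y = {φ(x), y} for all x,y ∈ V. -/
/-- If `mul` is a post-Lie algebra structure on `(g,n)` with `n` complete (every derivation
of `n` is inner and the center of `n` is trivial), then there is a unique linear map
`φ : V → V` with `x·y = {φ(x), y}`. -/
theorem exists_unique_phi_of_complete {k V : Type*} [Field k] [CharZero k]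
    [AddCommGroup V] [Module k V] [FiniteDimensional k V]
    (mul bg bn : V →ₗ[k] V →ₗ[k] V)
    (hbg : IsLieBracketOp bg) (hbn : IsLieBracketOp bn)
    (hder : ∀ D : V →ₗ[k] V,
      (∀ x y : V, D (bn x y) = bn (D x) y + bn x (D y)) → ∃ a : V, ∀ y : V, D y = bn a y)
    (hcenter : ∀ a : V, (∀ y : V, bn a y = 0) → a = 0)
    (h : IsPostLieStructure mul bg bn) :
    ∃! φ : V →ₗ[k] V, ∀ x y : V, mul x y = bn (φ x) y := by
  have hinj : Function.Injective bn := by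
    rw [injective_iff_map_eq_zero]
    intro a ha
    exact hcenter a fun y => by rw [ha, LinearMap.zero_apply]
  choose f hf using fun x => hder (mul x) (h.2.2 x)
  have hf' : ∀ x, bn (f x) = mul x := fun x => LinearMap.ext fun y => (hf x y).symm
  refine ⟨{ toFun := f, map_add' := fun x y => hinj ?_, map_smul' := fun c x => hinj ?_ },
    hf, fun ψ hψ => LinearMap.ext fun x => hinj ?_⟩
  · rw [map_add, hf', hf', hf', map_add]
  · rw [RingHom.id_apply, map_smul, hf', hf', map_smul]
  · exact LinearMap.ext fun y => (hψ x y).symm.trans (hf x y)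
end

section
/- Let (g,n) be a pair of Lie algebras on a vector space V such that the center of n is trivial, and let φ: V → V be a linear map. Then the product x·y := {φ(x), y} is a post-Lie algebra structure on (g,n) if and only if both of the following hold for all x,y ∈ V: {φ(x), y} + {x, φ(y)} = [x,y] − {x,y}, and φ([x,y]) = {φ(x), φ(y)} (i.e. φ is a Lie algebra homomorphism from g to n). -/
/-- A Lie bracket acts on itself by derivations. -/
theorem IsLieBracketOp.leibniz {k V : Type*} [Field k] [AddCommGroup V] [Module k V]
    {B : V →ₗ[k] V →ₗ[k] V} (hB : IsLieBracketOp B) (x y z : V) :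
    B x (B y z) = B (B x y) z + B y (B x z) := by
  have skew (a b : V) : B a b = -B b a := eq_neg_of_add_eq_zero_left (hB.1 a b)
  have jacobi := hB.2 x y z
  rw [skew (B y z) x, skew (B z x) y, skew z x, map_neg, neg_neg] at jacobi
  rw [← sub_eq_zero, ← neg_eq_zero, ← jacobi]
  abel

/-- For a pair `(g,n)` with `Z(n) = 0` and a linear map `φ`, the product
`x·y = {φ(x), y}` is a post-Lie algebra structure on `(g,n)` if and only if
`{φ(x),y} + {x,φ(y)} = [x,y] - {x,y}` and `φ` is a Lie algebra homomorphism from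
`g` to `n`. -/
theorem isPostLieStructure_phi_iff {k V : Type*} [Field k] [CharZero k]
    [AddCommGroup V] [Module k V] [FiniteDimensional k V]
    (bg bn : V →ₗ[k] V →ₗ[k] V)
    (hbg : IsLieBracketOp bg) (hbn : IsLieBracketOp bn)
    (hcenter : ∀ a : V, (∀ y : V, bn a y = 0) → a = 0)
    (φ : V →ₗ[k] V) :
    IsPostLieStructure (bn ∘ₗ φ) bg bn ↔
      ((∀ x y : V, bn (φ x) y + bn x (φ y) = bg x y - bn x y) ∧
       (∀ x y : V, φ (bg x y) = bn (φ x) (φ y))) := by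
  have skew (a b : V) : bn a b = -bn b a := eq_neg_of_add_eq_zero_left (hbn.1 a b)
  simp only [IsPostLieStructure, LinearMap.comp_apply]
  have symm_part (x y : V) :
      bn (φ x) y - bn (φ y) x = bn (φ x) y + bn x (φ y) := by
    rw [skew x (φ y), sub_eq_add_neg]
  simp only [symm_part]
  refine and_congr_right fun _ => ⟨fun h x y => ?_, fun h => ⟨fun x y z => ?_, fun x y z => ?_⟩⟩
  · refine sub_eq_zero.mp (hcenter _ fun z => ?_)
    rw [map_sub, LinearMap.sub_apply, h.1 x y z, hbn.leibniz (φ x) (φ y) z]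
    abel
  · rw [h, hbn.leibniz (φ x) (φ y) z, add_sub_cancel_right]
  · exact hbn.leibniz (φ x) y z
end

section
/- Let (g,n) be a pair of Lie algebras on a vector space V. There is a bijective correspondence between post-Lie algebra structures on (g,n) and Lie subalgebras h of the semidirect product n ⋊ Der(n) for which the projection p₁: n ⋊ Der(n) → V onto the first factor restricts to a Lie algebra isomorphism from h onto g. The correspondence assigns to a post-Lie algebra structure x·y, with left multiplications L(x)y = x·y, the subalgebra h = {(x, L(x)) : x ∈ V}. -/
/-- A post-Lie algebra structure on the pair of Lie algebras `(g, n)`, whose underlying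
vector spaces are identified via the linear equivalence `e : g ≃ₗ[k] n`.  The product is
recorded as a bilinear map `P` on `n`. -/
def IsPostLiePair {k g n : Type*} [Field k] [LieRing g] [LieAlgebra k g]
    [LieRing n] [LieAlgebra k n] (e : g ≃ₗ[k] n) (P : n →ₗ[k] n →ₗ[k] n) : Prop :=
  (∀ x y : n, P x y - P y x = e ⁅e.symm x, e.symm y⁆ - ⁅x, y⁆) ∧
  (∀ x y z : n, P (e ⁅e.symm x, e.symm y⁆) z = P x (P y z) - P y (P x z)) ∧
  (∀ x y z : n, P x ⁅y, z⁆ = ⁅P x y, z⁆ + ⁅y, P x z⁆)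

/-- The bracket of the semidirect product `n ⋊ Der(n)`:
`[(x,D),(x',D')] = ({x,x'} + D(x') - D'(x), [D,D'])`. -/
def sdBracket (k : Type*) {n : Type*} [Field k] [LieRing n] [LieAlgebra k n]
    (a b : n × LieDerivation k n n) : n × LieDerivation k n n :=
  (⁅a.1, b.1⁆ + a.2 b.1 - b.2 a.1, ⁅a.2, b.2⁆)

namespace IsPostLiePair

variable {k g n : Type*} [Field k] [LieRing g] [LieAlgebra k g] [LieRing n] [LieAlgebra k n]
  {e : g ≃ₗ[k] n} {P : n →ₗ[k] n →ₗ[k] n}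

/-- Left multiplication in a post-Lie structure, as a derivation of `n`. -/
def leftDerivation (hP : IsPostLiePair e P) : n →ₗ[k] LieDerivation k n n where
  toFun x :=
    { toLinearMap := P x
      leibniz' := fun y z => by
        rw [hP.2.2 x y z, ← lie_skew z (P x y)]
        abel }
  map_add' x y := by ext z; simp
  map_smul' c x := by ext z; simp

theorem mem_graph_leftDerivation (hP : IsPostLiePair e P) (s : n × LieDerivation k n n) :
    s ∈ hP.leftDerivation.graph ↔ ∀ y : n, s.2 y = P s.1 y := by
  rw [LinearMap.mem_graph_iff, LieDerivation.ext_iff]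
  rfl

theorem sdBracket_graph_fst (hP : IsPostLiePair e P) {a b : n × LieDerivation k n n}
    (ha : a ∈ hP.leftDerivation.graph) (hb : b ∈ hP.leftDerivation.graph) :
    (sdBracket k a b).1 = e ⁅e.symm a.1, e.symm b.1⁆ := by
  rw [mem_graph_leftDerivation] at ha hb
  have h := hP.1 a.1 b.1
  simp only [sdBracket, ha, hb]
  rw [add_sub_assoc, h]
  abel

theorem sdBracket_mem_graph (hP : IsPostLiePair e P) {a b : n × LieDerivation k n n}
    (ha : a ∈ hP.leftDerivation.graph) (hb : b ∈ hP.leftDerivation.graph) :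
    sdBracket k a b ∈ hP.leftDerivation.graph := by
  rw [mem_graph_leftDerivation, hP.sdBracket_graph_fst ha hb]
  rw [mem_graph_leftDerivation] at ha hb
  intro y
  simp [sdBracket, LieDerivation.lie_apply, ha, hb, hP.2.1]

theorem bijective_graph_fst (hP : IsPostLiePair e P) :
    Function.Bijective (fun a : hP.leftDerivation.graph =>
      e.symm (a : n × LieDerivation k n n).1) := by
  refine ⟨fun a b hab => ?_, fun x => ⟨⟨(e x, hP.leftDerivation (e x)), ?_⟩, by simp⟩⟩
  · have h1 : a.1.1 = b.1.1 := e.symm.injective hab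
    have ha := (LinearMap.mem_graph_iff _ _).1 a.2
    have hb := (LinearMap.mem_graph_iff _ _).1 b.2
    exact Subtype.ext (Prod.ext h1 (by rw [ha, hb, h1]))
  · simp [LinearMap.mem_graph_iff]

/-- A linear map into `Der(n)` whose graph is closed under the semidirect bracket and projects
homomorphically to `g` defines a post-Lie structure. -/
theorem of_graph {L : n →ₗ[k] LieDerivation k n n}
    (hL : ∀ a ∈ L.graph, ∀ b ∈ L.graph, sdBracket k a b ∈ L.graph)
    (hg : ∀ a ∈ L.graph, ∀ b ∈ L.graph,
      e.symm (sdBracket k a b).1 = ⁅e.symm a.1, e.symm b.1⁆) :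
    IsPostLiePair e ((LieDerivation.toLinearMapLieHom k n : _ →ₗ[k] _) ∘ₗ L) := by
  have mem (x : n) : (x, L x) ∈ L.graph := by simp [LinearMap.mem_graph_iff]
  have hfst (x y : n) : e ⁅e.symm x, e.symm y⁆ = ⁅x, y⁆ + L x y - L y x := by
    rw [← hg _ (mem x) _ (mem y), e.apply_symm_apply]
    rfl
  refine ⟨fun x y => ?_, fun x y z => ?_, fun x y z => ?_⟩
  · change L x y - L y x = _
    rw [hfst]
    abel
  · change L _ z = L x (L y z) - L y (L x z)
    have h := (LinearMap.mem_graph_iff _ _).1 (hL _ (mem x) _ (mem y))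
    rw [hfst, ← LieDerivation.lie_apply]
    exact (DFunLike.congr_fun h z).symm
  · change L x _ = ⁅L x y, z⁆ + ⁅y, L x z⁆
    rw [LieDerivation.apply_lie_eq_sub, ← lie_skew z (L x y)]
    abel

end IsPostLiePair

/-- Proposition 2.10: there is a bijective correspondence between post-Lie algebra
structures on `(g,n)` and Lie subalgebras `h` of `n ⋊ Der(n)` for which the projection
onto the first factor restricts to a Lie algebra isomorphism of `h` onto `g`; it assigns
to a post-Lie structure with left multiplications `L(x)` the subalgebra
`h = {(x, L(x)) : x ∈ V}`. -/
theorem postLiePair_equiv_subalgebras {k g n : Type*} [Field k] [CharZero k]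
    [LieRing g] [LieAlgebra k g] [LieRing n] [LieAlgebra k n]
    [FiniteDimensional k n] (e : g ≃ₗ[k] n) :
    ∃ F : {P : n →ₗ[k] n →ₗ[k] n // IsPostLiePair e P} ≃
        {h : Submodule k (n × LieDerivation k n n) //
          (∀ a ∈ h, ∀ b ∈ h, sdBracket k a b ∈ h) ∧
          Function.Bijective
            (fun a : h => e.symm (a : n × LieDerivation k n n).1) ∧
          (∀ a ∈ h, ∀ b ∈ h,
            e.symm (sdBracket k a b).1 = ⁅e.symm a.1, e.symm b.1⁆)},
      ∀ (P : {P : n →ₗ[k] n →ₗ[k] n // IsPostLiePair e P})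
        (s : n × LieDerivation k n n),
        s ∈ (F P).val ↔ ∀ y : n, s.2 y = P.val s.1 y := by
  refine ⟨Equiv.ofBijective (fun P => ⟨P.2.leftDerivation.graph,
    fun a ha b hb => P.2.sdBracket_mem_graph ha hb, P.2.bijective_graph_fst,
    fun a ha b hb => by rw [P.2.sdBracket_graph_fst ha hb, e.symm_apply_apply]⟩) ⟨?_, ?_⟩,
    fun P s => P.2.mem_graph_leftDerivation s⟩
  · intro P Q hPQ
    have h : P.2.leftDerivation.graph = Q.2.leftDerivation.graph := congrArg Subtype.val hPQ
    ext x y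
    have hx : (x, P.2.leftDerivation x) ∈ Q.2.leftDerivation.graph := by
      simp [← h, LinearMap.mem_graph_iff]
    exact (Q.2.mem_graph_leftDerivation _).1 hx y
  · rintro ⟨h, hclosed, hbij, hg⟩
    obtain ⟨L, rfl⟩ := Submodule.exists_eq_graph (G := h)
      ((e.symm.bijective.of_comp_iff' _).1 hbij)
    exact ⟨⟨_, IsPostLiePair.of_graph hclosed hg⟩, rfl⟩
end

section
/- Let n be a semisimple Lie algebra over k on a vector space V, and let (g,n) be a pair of Lie algebras. There is a bijective correspondence between post-Lie algebra structures on (g,n) and Lie subalgebras h of the direct sum n ⊕ n for which the map p₁ − p₂: n ⊕ n → V, (x,y) ↦ x − y, restricts to a Lie algebra isomorphism from h onto g. -/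
namespace PostLiePair

variable {k n : Type*} [Field k] [LieRing n] [LieAlgebra k n]

/-- The subspace of `n × n` of all `(a, b)` such that `P (a - b)` is the inner derivation
given by `b`. -/
def subspace (P : n →ₗ[k] n →ₗ[k] n) : Submodule k (n × n) :=
  LinearMap.ker ((LieAlgebra.ad k n : n →ₗ[k] Module.End k n) ∘ₗ LinearMap.snd k n n -
    P ∘ₗ (LinearMap.fst k n n - LinearMap.snd k n n))

lemma mem_subspace {P : n →ₗ[k] n →ₗ[k] n} {a : n × n} :
    a ∈ subspace P ↔ ∀ z, P (a.1 - a.2) z = ⁅a.2, z⁆ := by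
  simp only [subspace, LinearMap.mem_ker, LinearMap.sub_apply, LinearMap.comp_apply, sub_eq_zero,
    LinearMap.ext_iff]
  exact forall_congr' fun z ↦ eq_comm

lemma eq_of_lie_eq_lie [LieAlgebra.HasTrivialRadical k n] {x y : n}
    (h : ∀ z : n, ⁅x, z⁆ = ⁅y, z⁆) : x = y := by
  have hxy : x - y ∈ LieAlgebra.center k n := by
    rw [LieModule.mem_maxTrivSubmodule]
    intro z
    rw [← lie_skew, sub_lie, h z, sub_self, neg_zero]
  rw [LieAlgebra.center_eq_bot, LieSubmodule.mem_bot] at hxy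
  exact sub_eq_zero.mp hxy

lemma exists_eq_lie_of_leibniz [FiniteDimensional k n] [LieAlgebra.IsKilling k n]
    (D : n →ₗ[k] n) (hD : ∀ y z, D ⁅y, z⁆ = ⁅D y, z⁆ + ⁅y, D z⁆) :
    ∃ u : n, ∀ z, D z = ⁅u, z⁆ := by
  obtain ⟨u, hu⟩ := LieDerivation.IsKilling.exists_eq_ad
    (⟨D, fun y z ↦ by rw [hD, ← lie_skew z (D y)]; abel⟩ : LieDerivation k n n)
  exact ⟨u, fun z ↦ by simpa using (LieDerivation.congr_fun hu z).symm⟩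

variable {g : Type*} [LieRing g] [LieAlgebra k g]

/-- The Lie subalgebras of `n ⊕ n` that `p₁ - p₂` maps isomorphically onto `g`. -/
def IsGraph (e : g ≃ₗ[k] n) (h : Submodule k (n × n)) : Prop :=
  (∀ a ∈ h, ∀ b ∈ h, ((⁅a.1, b.1⁆, ⁅a.2, b.2⁆) : n × n) ∈ h) ∧
    Function.Bijective (fun a : h => e.symm ((a : n × n).1 - (a : n × n).2)) ∧
    (∀ a ∈ h, ∀ b ∈ h,
      e.symm ((⁅a.1, b.1⁆ : n) - ⁅a.2, b.2⁆) = ⁅e.symm (a.1 - a.2), e.symm (b.1 - b.2)⁆)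

lemma IsGraph.exists_sub_eq {e : g ≃ₗ[k] n} {h : Submodule k (n × n)} (hh : IsGraph e h) (x : n) :
    ∃ a ∈ h, a.1 - a.2 = x := by
  obtain ⟨a, ha⟩ := hh.2.1.2 (e.symm x)
  exact ⟨a, a.2, e.symm.injective ha⟩

lemma isGraph_subspace [FiniteDimensional k n] [LieAlgebra.IsKilling k n] {e : g ≃ₗ[k] n}
    {P : n →ₗ[k] n →ₗ[k] n} (hP : IsPostLiePair e P) : IsGraph e (subspace P) := by
  obtain ⟨h₁, h₂, h₃⟩ := hP
  have key : ∀ a ∈ subspace P, ∀ b ∈ subspace P,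
      (⁅a.1, b.1⁆ : n) - ⁅a.2, b.2⁆ = e ⁅e.symm (a.1 - a.2), e.symm (b.1 - b.2)⁆ := by
    intro a ha b hb
    rw [mem_subspace] at ha hb
    have h := h₁ (a.1 - a.2) (b.1 - b.2)
    rw [ha, hb, eq_sub_iff_add_eq] at h
    rw [← h, ← lie_skew b.2]
    simp only [lie_sub, sub_lie]
    abel
  refine ⟨fun a ha b hb ↦ ?_, ⟨fun a b hab ↦ ?_, fun x ↦ ?_⟩, fun a ha b hb ↦ ?_⟩
  · have hk := key a ha b hb
    rw [mem_subspace] at ha hb ⊢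
    intro z
    simp only [hk, h₂, ha, hb, lie_lie]
  · have h : (a : n × n).1 - (a : n × n).2 = (b : n × n).1 - (b : n × n).2 :=
      e.symm.injective hab
    have h' : (a : n × n).2 = (b : n × n).2 := eq_of_lie_eq_lie (k := k) fun z ↦ by
      rw [← mem_subspace.mp a.2, ← mem_subspace.mp b.2, h]
    rw [h'] at h
    exact Subtype.ext (Prod.ext (sub_left_injective h) h')
  · obtain ⟨u, hu⟩ := exists_eq_lie_of_leibniz (P (e x)) (h₃ (e x))
    exact ⟨⟨(e x + u, u), mem_subspace.mpr (by simpa using hu)⟩, by simp⟩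
  · rw [key a ha b hb, e.symm_apply_apply]

lemma subspace_injOn {e : g ≃ₗ[k] n} {P Q : n →ₗ[k] n →ₗ[k] n} (hP : IsGraph e (subspace P))
    (h : subspace P = subspace Q) : P = Q := by
  ext x z
  obtain ⟨a, ha, rfl⟩ := hP.exists_sub_eq x
  rw [mem_subspace.mp ha, mem_subspace.mp (h ▸ ha)]

lemma exists_subspace_eq [LieAlgebra.HasTrivialRadical k n] {e : g ≃ₗ[k] n}
    {h : Submodule k (n × n)} (hh : IsGraph e h) :
    ∃ P, IsPostLiePair e P ∧ subspace P = h := by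
  have hbij : Function.Bijective ((LinearMap.fst k n n - LinearMap.snd k n n) ∘ₗ h.subtype) := by
    simpa [Function.comp_def] using e.bijective.comp hh.2.1
  let E : h ≃ₗ[k] n := LinearEquiv.ofBijective _ hbij
  let P : n →ₗ[k] n →ₗ[k] n := (LieAlgebra.ad k n : n →ₗ[k] Module.End k n) ∘ₗ
    LinearMap.snd k n n ∘ₗ h.subtype ∘ₗ E.symm
  have hP : ∀ a ∈ h, ∀ z, P (a.1 - a.2) z = ⁅a.2, z⁆ := fun a ha z ↦ by
    have : E.symm (a.1 - a.2) = ⟨a, ha⟩ := E.symm_apply_eq.mpr rfl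
    simp [P, this]
  obtain ⟨hmem, -, hmul⟩ := id hh
  have hmul' : ∀ a ∈ h, ∀ b ∈ h,
      e ⁅e.symm (a.1 - a.2), e.symm (b.1 - b.2)⁆ = (⁅a.1, b.1⁆ : n) - ⁅a.2, b.2⁆ :=
    fun a ha b hb ↦ by rw [← hmul a ha b hb, e.apply_symm_apply]
  refine ⟨P, ⟨fun x y ↦ ?_, fun x y z ↦ ?_, fun x y z ↦ ?_⟩, le_antisymm (fun a ha ↦ ?_)
    fun a ha ↦ mem_subspace.mpr (hP a ha)⟩
  · obtain ⟨a, ha, rfl⟩ := hh.exists_sub_eq x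
    obtain ⟨b, hb, rfl⟩ := hh.exists_sub_eq y
    rw [hP a ha, hP b hb, hmul' a ha b hb, ← lie_skew b.2]
    simp only [lie_sub, sub_lie]
    abel
  · obtain ⟨a, ha, rfl⟩ := hh.exists_sub_eq x
    obtain ⟨b, hb, rfl⟩ := hh.exists_sub_eq y
    rw [hmul' a ha b hb, hP _ (hmem a ha b hb)]
    simp only [hP a ha, hP b hb, lie_lie]
  · obtain ⟨a, ha, rfl⟩ := hh.exists_sub_eq x
    rw [hP a ha, hP a ha, hP a ha, leibniz_lie]
  · obtain ⟨b, hb, hab⟩ := hh.exists_sub_eq (a.1 - a.2)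
    have h' : b.2 = a.2 := eq_of_lie_eq_lie (k := k) fun z ↦ by
      rw [← hP b hb, ← mem_subspace.mp ha, hab]
    rw [h'] at hab
    rwa [← show b = a from Prod.ext (sub_left_injective hab) h']

end PostLiePair


/-- Proposition 2.12: for `n` semisimple, there is a bijective correspondence between
post-Lie algebra structures on `(g,n)` and Lie subalgebras `h` of the direct sum `n ⊕ n`
(with componentwise bracket) for which the map `p₁ - p₂ : (x,y) ↦ x - y` restricts to a
Lie algebra isomorphism of `h` onto `g`. -/
theorem postLiePair_equiv_subalgebras_of_semisimple {k g n : Type*} [Field k] [CharZero k]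
    [LieRing g] [LieAlgebra k g] [LieRing n] [LieAlgebra k n]
    [FiniteDimensional k n] [LieAlgebra.IsSemisimple k n] (e : g ≃ₗ[k] n) :
    Nonempty ({P : n →ₗ[k] n →ₗ[k] n // IsPostLiePair e P} ≃
      {h : Submodule k (n × n) //
        (∀ a ∈ h, ∀ b ∈ h, ((⁅a.1, b.1⁆, ⁅a.2, b.2⁆) : n × n) ∈ h) ∧
        Function.Bijective
          (fun a : h => e.symm ((a : n × n).1 - (a : n × n).2)) ∧
        (∀ a ∈ h, ∀ b ∈ h,
          e.symm ((⁅a.1, b.1⁆ : n) - ⁅a.2, b.2⁆) =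
            ⁅e.symm (a.1 - a.2), e.symm (b.1 - b.2)⁆)}) := by
  have hK : LieAlgebra.IsKilling k n := inferInstance
  exact ⟨Equiv.ofBijective
    (fun P ↦ ⟨PostLiePair.subspace P.1, PostLiePair.isGraph_subspace P.2⟩)
    ⟨fun P Q h ↦ Subtype.ext (PostLiePair.subspace_injOn (PostLiePair.isGraph_subspace P.2)
      (congrArg Subtype.val h)),
    fun h ↦ by
      obtain ⟨P, hP, hPh⟩ := PostLiePair.exists_subspace_eq h.2
      exact ⟨⟨P, hP⟩, Subtype.ext hPh⟩⟩⟩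
end

section
/- Let (g,n) be a pair of Lie algebras over a field k of characteristic 0 and let λ ∈ k with λ ∉ {0,1}. Then the product x·y := λ[x,y] defines a post-Lie algebra structure on (g,n) if and only if {x,y} = (1 − 2λ)[x,y] for all x,y ∈ V, and both g and n are nilpotent of class at most 2 (i.e. [[x,y],z] = 0 and {{x,y},z} = 0 for all x,y,z ∈ V). -/
/-- The Jacobi identity in derivation form. -/
theorem IsLieBracketOp.apply_apply_sub {k V : Type*} [Field k] [AddCommGroup V] [Module k V]
    {B : V →ₗ[k] V →ₗ[k] V} (hB : IsLieBracketOp B) (x y z : V) :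
    B x (B y z) - B y (B x z) = B (B x y) z := by
  have hxz : B x z = -B z x := eq_neg_of_add_eq_zero_left (hB.1 x z)
  have hx : B x (B y z) = -B (B y z) x := eq_neg_of_add_eq_zero_left (hB.1 _ _)
  have hy : B y (B z x) = -B (B z x) y := eq_neg_of_add_eq_zero_left (hB.1 _ _)
  rw [hxz, map_neg, hx, hy, ← sub_eq_zero, ← neg_eq_zero, ← hB.2 x y z]
  abel

/-- Proposition 3.1: for `λ ∉ {0,1}`, the product `x·y = λ[x,y]` defines a post-Lie
algebra structure on `(g,n)` if and only if `{x,y} = (1-2λ)[x,y]` and both `g` and `n`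
are nilpotent of class at most 2. -/
theorem isPostLieStructure_smul_iff {k V : Type*} [Field k] [CharZero k]
    [AddCommGroup V] [Module k V] [FiniteDimensional k V]
    (bg bn : V →ₗ[k] V →ₗ[k] V)
    (hbg : IsLieBracketOp bg) (hbn : IsLieBracketOp bn)
    (lam : k) (h0 : lam ≠ 0) (h1 : lam ≠ 1) :
    IsPostLieStructure (lam • bg) bg bn ↔
      ((∀ x y : V, bn x y = (1 - 2 * lam) • bg x y) ∧
       (∀ x y z : V, bg (bg x y) z = 0) ∧
       (∀ x y z : V, bn (bn x y) z = 0)) := by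
  constructor
  · rintro ⟨hcomm, hmul, -⟩
    have hn (x y : V) : bn x y = (1 - 2 * lam) • bg x y := by
      have h := hcomm x y
      simp only [LinearMap.smul_apply, eq_neg_of_add_eq_zero_right (hbg.1 x y)] at h
      rw [← sub_eq_zero, ← sub_eq_zero.mpr h]
      module
    have hg (x y z : V) : bg (bg x y) z = 0 := by
      have h := hmul x y z
      simp only [LinearMap.smul_apply, map_smul] at h
      rw [← smul_sub, ← smul_sub, hbg.apply_apply_sub] at h
      have h' := smul_right_injective V h0 h
      have h'' : (1 - lam) • bg (bg x y) z = 0 := by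
        rw [sub_smul, one_smul, sub_eq_zero]
        exact h'
      exact (smul_eq_zero.mp h'').resolve_left (sub_ne_zero.mpr h1.symm)
    exact ⟨hn, hg, fun x y z => by simp [hn, hg]⟩
  · rintro ⟨hn, hg, -⟩
    have hg' (x y z : V) : bg x (bg y z) = 0 := by
      rw [eq_neg_of_add_eq_zero_left (hbg.1 _ _), hg, neg_zero]
    refine ⟨fun x y => ?_, fun x y z => by simp [hg, hg'], fun x y z => by simp [hn, hg, hg']⟩
    simp only [LinearMap.smul_apply, hn, eq_neg_of_add_eq_zero_right (hbg.1 x y)]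
    module
end

section
/- Let (g,n) be a pair of Lie algebras over k such that n is nilpotent of class at most 2 (i.e. {{x,y},z} = 0 for all x,y,z). If there exists a post-Lie algebra structure on (g,n), then g admits a pre-Lie algebra structure, i.e. a bilinear product x∗y on V with x∗y − y∗x = [x,y] and [x,y]∗z = x∗(y∗z) − y∗(x∗z) for all x,y,z ∈ V. -/
/-- Proposition 4.2: if `n` is nilpotent of class at most 2 and `(g,n)` admits a post-Lie
algebra structure, then `g` admits a pre-Lie algebra structure. -/
theorem preLie_of_postLie_two_step {k V : Type*} [Field k] [CharZero k]
    [AddCommGroup V] [Module k V] [FiniteDimensional k V]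
    (bg bn : V →ₗ[k] V →ₗ[k] V)
    (hbg : IsLieBracketOp bg) (hbn : IsLieBracketOp bn)
    (h2 : ∀ x y z : V, bn (bn x y) z = 0)
    (h : ∃ mul : V →ₗ[k] V →ₗ[k] V, IsPostLieStructure mul bg bn) :
    ∃ Q : V →ₗ[k] V →ₗ[k] V,
      (∀ x y : V, Q x y - Q y x = bg x y) ∧
      (∀ x y z : V, Q (bg x y) z = Q x (Q y z) - Q y (Q x z)) := by
  obtain ⟨mul, hsub, hrep, hder⟩ := h
  have anti (x y : V) : bn y x = -bn x y := eq_neg_of_add_eq_zero_right (hbn.1 x y)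
  have h2' (x y z : V) : bn x (bn y z) = 0 := by rw [anti, h2, neg_zero]
  have hbg_eq (x y : V) : bg x y = mul x y - mul y x + bn x y := by rw [hsub, sub_add_cancel]
  have had (x y z : V) : bn (bg x y) z = bn (mul x y) z - bn (mul y x) z := by
    rw [hbg_eq, map_add, map_sub, LinearMap.add_apply, LinearMap.sub_apply, h2, add_zero]
  refine ⟨mul + (2⁻¹ : k) • bn, fun x y => ?_, fun x y z => ?_⟩
  · simp only [LinearMap.add_apply, LinearMap.smul_apply, anti x y, hbg_eq]
    module
  · simp only [LinearMap.add_apply, LinearMap.smul_apply, map_add, map_smul, hrep, had, hder,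
      h2']
    module
end

section
/- Let (g,n) be a pair of complex Lie algebras on a finite-dimensional vector space V, and suppose that there exists a post-Lie algebra structure on (g,n) with g isomorphic to sl₂(ℂ). Then n is isomorphic to sl₂(ℂ). -/
open Module LieAlgebra.SpecialLinear

attribute [local instance] LieRing.ofAssociativeRing

theorem exists_smul_add_eq {K V : Type*} [Field K] [AddCommGroup V] [Module K V]
    (hV : finrank K V = 3) {v₀ v₁ v₂ : V} (hv : LinearIndependent K ![v₀, v₁, v₂]) (x : V) :
    ∃ a b c : K, x = a • v₀ + b • v₁ + c • v₂ := by
  have hx : x ∈ Submodule.span K (Set.range ![v₀, v₁, v₂]) := by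
    have : FiniteDimensional K V := .of_finrank_pos (by omega)
    rw [hv.span_eq_top_of_card_eq_finrank' (by simp [hV])]
    trivial
  rw [Submodule.mem_span_range_iff_exists_fun] at hx
  obtain ⟨c, hc⟩ := hx
  exact ⟨c 0, c 1, c 2, by simpa [Fin.sum_univ_three] using hc.symm⟩

theorem linearIndependent_triple_iff {K V : Type*} [Field K] [AddCommGroup V] [Module K V]
    {v₀ v₁ v₂ : V} : LinearIndependent K ![v₀, v₁, v₂] ↔
      ∀ a b c : K, a • v₀ + b • v₁ + c • v₂ = 0 → a = 0 ∧ b = 0 ∧ c = 0 := by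
  rw [Fintype.linearIndependent_iff]
  constructor
  · intro h a b c habc
    have := h ![a, b, c] (by simpa [Fin.sum_univ_three] using habc)
    exact ⟨this 0, this 1, this 2⟩
  · intro h g hg i
    have := h (g 0) (g 1) (g 2) (by simpa [Fin.sum_univ_three] using hg)
    fin_cases i <;> simp [this]

theorem isSl2Triple_sl_two :
    IsSl2Triple (singleSubSingle (0 : Fin 2) 1 (1 : ℂ)) (single (0 : Fin 2) 1 (by decide) 1)
      (single (1 : Fin 2) 0 (by decide) 1) := by
  refine ⟨fun h ↦ ?_, ?_, ?_, ?_⟩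
  · have := congrFun₂ (congrArg Subtype.val h) 0 0
    simp at this
  all_goals
    ext i j
    fin_cases i <;> fin_cases j <;>
      simp [Ring.lie_def, Matrix.mul_apply, Matrix.single_apply] <;> norm_num

theorem linearIndependent_sl_two :
    LinearIndependent ℂ ![singleSubSingle (0 : Fin 2) 1 (1 : ℂ), single (0 : Fin 2) 1 (by decide) 1,
      single (1 : Fin 2) 0 (by decide) 1] := by
  rw [linearIndependent_triple_iff]
  intro a b c h
  have h00 := congrFun₂ (congrArg Subtype.val h) 0 0
  have h01 := congrFun₂ (congrArg Subtype.val h) 0 1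
  have h10 := congrFun₂ (congrArg Subtype.val h) 1 0
  simp at h00 h01 h10
  exact ⟨h00, h01, h10⟩

theorem finrank_sl_two : finrank ℂ (sl (Fin 2) ℂ) = 3 := by
  have hspan : ⊤ ≤ Submodule.span ℂ (Set.range ![singleSubSingle (0 : Fin 2) 1 (1 : ℂ),
      single (0 : Fin 2) 1 (by decide) 1, single (1 : Fin 2) 0 (by decide) 1]) := by
    rintro x -
    rw [Submodule.mem_span_range_iff_exists_fun]
    refine ⟨![x.val 0 0, x.val 0 1, x.val 1 0], ?_⟩
    have hx : x.val 0 0 + x.val 1 1 = 0 := by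
      have := x.property
      change Matrix.trace x.val = 0 at this
      simpa [Matrix.trace_fin_two] using this
    ext i j
    fin_cases i <;> fin_cases j <;> simp [Fin.sum_univ_three]
    linear_combination -hx
  simpa using finrank_eq_card_basis (Basis.mk linearIndependent_sl_two hspan)

theorem IsSl2Triple.lie_swap {L : Type*} [LieRing L] {h e f : L} (t : IsSl2Triple h e f) :
    ⁅e, h⁆ = -(2 • e) ∧ ⁅f, h⁆ = 2 • f ∧ ⁅f, e⁆ = -h := by
  refine ⟨?_, ?_, ?_⟩ <;> rw [← lie_skew]
  · rw [t.lie_h_e_nsmul]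
  · rw [t.lie_h_f_nsmul, neg_neg]
  · rw [t.lie_e_f]

/-- Two three-dimensional Lie algebras, each with a linearly independent `sl₂`-triple, are
isomorphic. -/
theorem IsSl2Triple.nonempty_lieEquiv {K L L' : Type*} [Field K] [LieRing L] [LieAlgebra K L]
    [LieRing L'] [LieAlgebra K L'] {h e f : L} {h' e' f' : L'}
    (t : IsSl2Triple h e f) (t' : IsSl2Triple h' e' f')
    (hL : finrank K L = 3) (hL' : finrank K L' = 3)
    (hli : LinearIndependent K ![h, e, f]) (hli' : LinearIndependent K ![h', e', f']) :
    Nonempty (L ≃ₗ⁅K⁆ L') := by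
  let b := basisOfLinearIndependentOfCardEqFinrank hli (by simp [hL])
  let b' := basisOfLinearIndependentOfCardEqFinrank hli' (by simp [hL'])
  let φ : L ≃ₗ[K] L' := b.equiv b' (Equiv.refl _)
  have hφ (i : Fin 3) : φ (![h, e, f] i) = ![h', e', f'] i := by
    simpa [b, b'] using b.equiv_apply i b' (Equiv.refl _)
  have hh : φ h = h' := hφ 0
  have he : φ e = e' := hφ 1
  have hf : φ f = f' := hφ 2
  obtain ⟨s₁, s₂, s₃⟩ := t.lie_swap
  obtain ⟨s₁', s₂', s₃'⟩ := t'.lie_swap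
  refine ⟨{ φ with map_lie' := ?_ }⟩
  intro x y
  change φ ⁅x, y⁆ = ⁅φ x, φ y⁆
  obtain ⟨a, b, c, rfl⟩ := exists_smul_add_eq hL hli x
  obtain ⟨a', b', c', rfl⟩ := exists_smul_add_eq hL hli y
  simp only [lie_add, add_lie, lie_smul, smul_lie, map_add, map_smul, map_neg, map_nsmul, lie_self,
    t.lie_e_f, t.lie_h_e_nsmul, t.lie_h_f_nsmul, t'.lie_e_f, t'.lie_h_e_nsmul, t'.lie_h_f_nsmul,
    s₁, s₂, s₃, s₁', s₂', s₃', hh, he, hf, map_zero]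

namespace IsSl2Triple
variable {V : Type*} [AddCommGroup V] [Module ℂ V] [FiniteDimensional ℂ V] {H E F : End ℂ V}

theorem exists_primitive_of_eigenvalue (t : IsSl2Triple H E F) {μ : ℂ} (hμ : H.HasEigenvalue μ) :
    ∃ (k m : ℕ) (v : V), μ + 2 * k = m ∧ HasPrimitiveVectorWith t v (m : ℂ) := by
  obtain ⟨w, hw⟩ := hμ.exists_hasEigenvector
  have hH (k : ℕ) := t.lie_h_pow_toEnd_e (M := V) (m := w) hw.apply_eq_smul k
  have hz : ∃ k : ℕ, (LieModule.toEnd ℂ (End ℂ V) V E ^ k) w = 0 := by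
    by_contra! hne
    refine Set.infinite_of_injective_forall_mem (f := fun k : ℕ ↦ μ + 2 * (k : ℂ)) ?_ ?_
      (End.finite_hasEigenvalue H)
    · intro a b hab
      simpa using hab
    · exact fun k ↦ End.hasEigenvalue_of_hasEigenvector
        ⟨End.mem_eigenspace_iff.mpr (hH k), hne k⟩
  obtain ⟨k, hk, hk'⟩ := Nat.exists_not_and_succ_of_not_zero_of_exists hw.2 hz
  have hp : HasPrimitiveVectorWith t _ (μ + 2 * (k : ℂ)) :=
    ⟨hk, hH k, by rwa [lie_e_pow_toEnd_e]⟩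
  obtain ⟨m, hm⟩ := hp.exists_nat
  exact ⟨k, m, _, hm, hm ▸ hp⟩

theorem exists_eigenvalue_ne_zero (t : IsSl2Triple H E F) : ∃ μ ≠ 0, H.HasEigenvalue μ := by
  by_contra! hμ
  have htop : H.maxGenEigenspace 0 = ⊤ := by
    rw [← End.iSup_maxGenEigenspace_eq_top H]
    refine le_antisymm (le_iSup _ _) (iSup_le fun μ ↦ ?_)
    by_cases h0 : μ = 0
    · rw [h0]
    · have : H.maxGenEigenspace μ = ⊥ := by
        by_contra hb
        exact hμ μ h0 (End.HasUnifEigenvalue.lt (k := ⊤) zero_lt_one hb)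
      simp [this]
  have hnil : IsNilpotent H := by
    refine ⟨finrank ℂ V, LinearMap.ext fun x ↦ ?_⟩
    have hx : x ∈ H.maxGenEigenspace 0 := htop ▸ trivial
    rw [End.maxGenEigenspace_eq_genEigenspace_finrank, End.mem_genEigenspace_nat] at hx
    simpa using hx
  obtain ⟨k, hk⟩ := LieAlgebra.ad_nilpotent_of_nilpotent (R := ℂ) hnil
  have hpow (j : ℕ) : (LieAlgebra.ad ℂ (End ℂ V) H ^ j) E = (2 ^ j : ℂ) • E := by
    induction j with
    | zero => simp
    | succ j ih =>
      rw [pow_succ', Module.End.mul_apply, ih, map_smul, LieAlgebra.ad_apply, t.lie_h_e_smul ℂ,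
        smul_smul, pow_succ]
  have := hpow k
  rw [hk] at this
  exact t.e_ne_zero (by simpa using this.symm)

/-- A nontrivial `sl₂`-representation has a vector of positive highest weight, for the given triple
or for the opposite one. -/
theorem exists_primitive_pos (t : IsSl2Triple H E F) :
    (∃ (m : ℕ) (v : V), m ≠ 0 ∧ HasPrimitiveVectorWith t v (m : ℂ)) ∨
      ∃ (m : ℕ) (v : V), m ≠ 0 ∧ HasPrimitiveVectorWith t.symm v (m : ℂ) := by
  obtain ⟨μ, hμ, hHμ⟩ := t.exists_eigenvalue_ne_zero
  obtain ⟨k, m, v, hk, hv⟩ := t.exists_primitive_of_eigenvalue hHμ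
  have hneg : (-H).HasEigenvalue (-μ) := by
    obtain ⟨w, hw⟩ := hHμ.exists_hasEigenvector
    exact End.hasEigenvalue_of_hasEigenvector
      ⟨End.mem_eigenspace_iff.mpr (by simp [hw.apply_eq_smul]), hw.2⟩
  obtain ⟨k', m', v', hk', hv'⟩ := t.symm.exists_primitive_of_eigenvalue hneg
  by_cases hm : m = 0
  · refine .inr ⟨m', v', fun hm' ↦ hμ ?_, hv'⟩
    subst hm hm'
    have hkk : ((k + k' : ℕ) : ℂ) = 0 := by
      push_cast at hk hk' ⊢
      linear_combination (hk + hk') / 2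
    have : k = 0 := by norm_cast at hkk; omega
    subst this
    simpa using hk
  · exact .inl ⟨m, v, hm, hv⟩

end IsSl2Triple

/-- `H`, `E`, `F` are derivations of `n`, and `X`, `Y`, `Z` are linearly independent values, at the
standard basis of `sl₂`, of a crossed homomorphism `sl₂ → n` relative to them. -/
structure IsSl2CrossedHom {n : Type*} [LieRing n] [LieAlgebra ℂ n] (H E F : End ℂ n)
    (X Y Z : n) : Prop where
  map_lie_h : ∀ y z, H ⁅y, z⁆ = ⁅H y, z⁆ + ⁅y, H z⁆
  map_lie_e : ∀ y z, E ⁅y, z⁆ = ⁅E y, z⁆ + ⁅y, E z⁆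
  map_lie_f : ∀ y z, F ⁅y, z⁆ = ⁅F y, z⁆ + ⁅y, F z⁆
  lie_h_e : H Y - E X + ⁅X, Y⁆ = (2 : ℂ) • Y
  lie_h_f : H Z - F X + ⁅X, Z⁆ = (-2 : ℂ) • Z
  lie_e_f : E Z - F Y + ⁅Y, Z⁆ = X
  linearIndependent : LinearIndependent ℂ ![X, Y, Z]

namespace IsSl2CrossedHom

variable {n : Type*} [LieRing n] [LieAlgebra ℂ n] {H E F : End ℂ n} {X Y Z : n}

theorem symm (hc : IsSl2CrossedHom H E F X Y Z) : IsSl2CrossedHom (-H) F E (-X) Z Y where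
  map_lie_h y z := by
    simp only [LinearMap.neg_apply, hc.map_lie_h, neg_lie, lie_neg, neg_add]
  map_lie_e := hc.map_lie_f
  map_lie_f := hc.map_lie_e
  lie_h_e := by
    simp only [LinearMap.neg_apply, map_neg, neg_lie]
    linear_combination (norm := module) -hc.lie_h_f
  lie_h_f := by
    simp only [LinearMap.neg_apply, map_neg, neg_lie]
    linear_combination (norm := module) -hc.lie_h_e
  lie_e_f := by
    rw [← lie_skew]
    linear_combination (norm := module) -hc.lie_e_f
  linearIndependent := by
    have := hc.linearIndependent
    rw [linearIndependent_triple_iff] at this ⊢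
    intro a b c h
    obtain ⟨h₁, h₂, h₃⟩ := this (-a) c b (by linear_combination (norm := module) h)
    exact ⟨by simpa using h₁, h₃, h₂⟩

/-- If the derivations act on `n` as the adjoint representation, then `n ≅ sl₂`. -/
theorem nonempty_lieEquiv_of_adjoint (hc : IsSl2CrossedHom H E F X Y Z)
    (hn : finrank ℂ n = 3) {v₀ v₁ v₂ : n} (hli : LinearIndependent ℂ ![v₀, v₁, v₂])
    (hH₀ : H v₀ = (2 : ℂ) • v₀) (hH₁ : H v₁ = 0) (hH₂ : H v₂ = (-2 : ℂ) • v₂)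
    (hE₀ : E v₀ = 0) (hE₁ : E v₁ = (2 : ℂ) • v₀) (hE₂ : E v₂ = (2 : ℂ) • v₁)
    (hF₀ : F v₀ = v₁) (hF₁ : F v₁ = v₂) (hF₂ : F v₂ = 0) :
    Nonempty (n ≃ₗ⁅ℂ⁆ sl (Fin 2) ℂ) := by
  have hli' := linearIndependent_triple_iff.mp hli
  obtain ⟨a, b, c, h01⟩ := exists_smul_add_eq hn hli ⁅v₀, v₁⁆
  have hb : b = 0 ∧ c = 0 := by
    have := hc.map_lie_h v₀ v₁
    simp only [hH₀, hH₁, lie_zero, smul_lie, h01, map_add, map_smul, hH₂] at this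
    obtain ⟨-, h₂, h₃⟩ := hli' 0 (2 * b) (4 * c) (by linear_combination (norm := module) -this)
    exact ⟨by simpa using h₂, by simpa using h₃⟩
  have h01 : ⁅v₀, v₁⁆ = a • v₀ := by simp [h01, hb]
  have h02 : ⁅v₀, v₂⁆ = a • v₁ := by
    have := hc.map_lie_f v₀ v₁
    simpa [hF₀, hF₁, h01] using this.symm
  have h12 : ⁅v₁, v₂⁆ = a • v₂ := by
    have := hc.map_lie_f v₀ v₂
    simpa [hF₀, hF₁, hF₂, h02] using this.symm
  by_cases ha : a = 0
  · exfalso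
    have hcl := linearIndependent_triple_iff.mp hc.linearIndependent
    have h10 : ⁅v₁, v₀⁆ = 0 := by rw [← lie_skew]; simp [h01, ha]
    have h20 : ⁅v₂, v₀⁆ = 0 := by rw [← lie_skew]; simp [h02, ha]
    have h21 : ⁅v₂, v₁⁆ = 0 := by rw [← lie_skew]; simp [h12, ha]
    subst ha
    obtain ⟨x₀, x₁, x₂, rfl⟩ := exists_smul_add_eq hn hli X
    obtain ⟨y₀, y₁, y₂, rfl⟩ := exists_smul_add_eq hn hli Y
    obtain ⟨z₀, z₁, z₂, rfl⟩ := exists_smul_add_eq hn hli Z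
    have e₁ := hc.lie_h_e
    have e₂ := hc.lie_h_f
    have e₃ := hc.lie_e_f
    simp only [map_add, map_smul, hH₀, hH₁, hH₂, hE₀, hE₁, hE₂, hF₀, hF₁, hF₂, add_lie, lie_add,
      smul_lie, lie_smul, lie_self, h01, h02, h12, h10, h20, h21, smul_zero, zero_smul, add_zero,
      zero_add] at e₁ e₂ e₃
    obtain ⟨p₀, p₁, p₂⟩ := hli' (-2 * x₁) (-2 * y₁ - 2 * x₂) (-4 * y₂)
      (by linear_combination (norm := module) e₁)
    obtain ⟨q₀, q₁, q₂⟩ := hli' (4 * z₀) (2 * z₁ - x₀) (-x₁)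
      (by linear_combination (norm := module) e₂)
    obtain ⟨r₀, r₁, r₂⟩ := hli' (2 * z₁ - x₀) (2 * z₂ - y₀ - x₁) (-y₁ - x₂)
      (by linear_combination (norm := module) e₃)
    have hx₁ : x₁ = 0 := by linear_combination -q₂
    have hy₂ : y₂ = 0 := by linear_combination -p₂ / 4
    have hz₀ : z₀ = 0 := by linear_combination q₀ / 4
    have hx₀ : x₀ = 2 * z₁ := by linear_combination -r₀
    have hx₂ : x₂ = -y₁ := by linear_combination -r₂
    have hy₀ : y₀ = 2 * z₂ := by linear_combination -r₁ - hx₁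
    subst hx₁ hy₂ hz₀ hx₀ hx₂ hy₀
    obtain ⟨s₁, s₂, s₃⟩ := hcl z₂ (-z₁) y₁ (by module)
    have s₂ : z₁ = 0 := by simpa using s₂
    have := hcl 1 0 0 (by simp [s₂, s₃])
    simp at this
  · refine IsSl2Triple.nonempty_lieEquiv (h := (-2 / a) • v₁) (e := v₀) (f := (-2 / a ^ 2) • v₂)
      ⟨fun h0 ↦ ?_, ?_, ?_, ?_⟩ isSl2Triple_sl_two hn finrank_sl_two ?_ linearIndependent_sl_two
    · have := hli' 0 (-2 / a) 0 (by simpa using h0)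
      simp [ha] at this
    · rw [lie_smul, h02, smul_smul]
      congr 1
      field_simp
    · rw [smul_lie, ← lie_skew, h01, ← Nat.cast_smul_eq_nsmul ℂ, ← neg_smul, smul_smul]
      congr 1
      field_simp
      simp
    · rw [smul_lie, lie_smul, h12, ← Nat.cast_smul_eq_nsmul ℂ, smul_smul, smul_smul, smul_smul,
        ← neg_smul]
      congr 1
      field_simp
      simp
    · rw [linearIndependent_triple_iff]
      intro p q r h
      obtain ⟨h₁, h₂, h₃⟩ := hli' q (p * (-2 / a)) (r * (-2 / a ^ 2))
        (by linear_combination (norm := module) h)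
      exact ⟨by simpa [ha] using h₂, h₁, by simpa [ha] using h₃⟩

/-- The derivations cannot act on `n` as the sum of the natural and the trivial representation. -/
theorem false_of_natural_add_trivial (hc : IsSl2CrossedHom H E F X Y Z)
    (hn : finrank ℂ n = 3) {v₀ v₁ u : n} (hli : LinearIndependent ℂ ![v₀, v₁, u])
    (hH₀ : H v₀ = v₀) (hH₁ : H v₁ = -v₁) (hHu : H u = 0)
    (hE₀ : E v₀ = 0) (hE₁ : E v₁ = v₀) (hEu : E u = 0)
    (hF₀ : F v₀ = v₁) (hF₁ : F v₁ = 0) (hFu : F u = 0) : False := by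
  have hli' := linearIndependent_triple_iff.mp hli
  obtain ⟨a, b, c, h01⟩ := exists_smul_add_eq hn hli ⁅v₀, v₁⁆
  have hab : a = 0 ∧ b = 0 := by
    have := hc.map_lie_h v₀ v₁
    simp only [hH₀, hH₁, hHu, lie_neg, h01, map_add, map_smul] at this
    obtain ⟨h₁, h₂, -⟩ := hli' a (-b) 0 (by linear_combination (norm := module) this)
    exact ⟨h₁, by simpa using h₂⟩
  have h01 : ⁅v₀, v₁⁆ = c • u := by simp [h01, hab]
  obtain ⟨d, a', b', hu0⟩ := exists_smul_add_eq hn hli ⁅u, v₀⁆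
  have hab' : a' = 0 ∧ b' = 0 := by
    have := hc.map_lie_h u v₀
    simp only [hH₀, hH₁, hHu, zero_lie, zero_add, hu0, map_add, map_smul] at this
    obtain ⟨-, h₁, h₂⟩ := hli' 0 (2 * a') b' (by linear_combination (norm := module) -this)
    exact ⟨by simpa using h₁, h₂⟩
  have hu0 : ⁅u, v₀⁆ = d • v₀ := by simp [hu0, hab']
  have hu1 : ⁅u, v₁⁆ = d • v₁ := by
    have := hc.map_lie_f u v₀
    simpa [hF₀, hFu, hu0] using this.symm
  have hdc : d * c = 0 := by
    have := leibniz_lie u v₀ v₁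
    simp only [h01, hu0, hu1, lie_smul, smul_lie, lie_self, smul_zero] at this
    obtain ⟨-, -, h⟩ := hli' 0 0 (2 * (d * c)) (by linear_combination (norm := module) -this)
    simpa using h
  have h10 : ⁅v₁, v₀⁆ = -(c • u) := by rw [← lie_skew, h01]
  have h0u : ⁅v₀, u⁆ = -(d • v₀) := by rw [← lie_skew, hu0]
  have h1u : ⁅v₁, u⁆ = -(d • v₁) := by rw [← lie_skew, hu1]
  have hcl := linearIndependent_triple_iff.mp hc.linearIndependent
  have hspan := exists_smul_add_eq hn hc.linearIndependent u
  obtain ⟨x₀, x₁, x₂, rfl⟩ := exists_smul_add_eq hn hli X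
  obtain ⟨y₀, y₁, y₂, rfl⟩ := exists_smul_add_eq hn hli Y
  obtain ⟨z₀, z₁, z₂, rfl⟩ := exists_smul_add_eq hn hli Z
  have e₁ := hc.lie_h_e
  have e₂ := hc.lie_h_f
  have e₃ := hc.lie_e_f
  simp only [map_add, map_smul, hH₀, hH₁, hHu, hE₀, hE₁, hEu, hF₀, hF₁, hFu, add_lie, lie_add,
    smul_lie, lie_smul, lie_self, h01, hu0, hu1, h10, h0u, h1u, smul_zero, add_zero,
    zero_add] at e₁ e₂ e₃
  obtain ⟨p₀, p₁, p₂⟩ := hli' (-y₀ - x₁ + d * (x₂ * y₀ - x₀ * y₂))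
    (-3 * y₁ + d * (x₂ * y₁ - x₁ * y₂)) (-2 * y₂ + c * (x₀ * y₁ - x₁ * y₀))
    (by linear_combination (norm := module) e₁)
  obtain ⟨q₀, q₁, q₂⟩ := hli' (3 * z₀ + d * (x₂ * z₀ - x₀ * z₂))
    (z₁ - x₀ + d * (x₂ * z₁ - x₁ * z₂)) (2 * z₂ + c * (x₀ * z₁ - x₁ * z₀))
    (by linear_combination (norm := module) e₂)
  obtain ⟨r₀, r₁, r₂⟩ := hli' (z₁ - x₀ + d * (y₂ * z₀ - y₀ * z₂))
    (-y₀ - x₁ + d * (y₂ * z₁ - y₁ * z₂)) (-x₂ + c * (y₀ * z₁ - y₁ * z₀))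
    (by linear_combination (norm := module) e₃)
  rcases mul_eq_zero.mp hdc with rfl | rfl
  · have hy₁ : y₁ = 0 := by linear_combination -p₁ / 3
    have hz₀ : z₀ = 0 := by linear_combination q₀ / 3
    have hx₁ : x₁ = -y₀ := by linear_combination -p₀
    have hx₀ : x₀ = z₁ := by linear_combination -q₁
    subst hy₁ hz₀ hx₁ hx₀
    have hx₂ : x₂ = c * (y₀ * x₀) := by linear_combination -r₂
    have hy₂ : y₂ = c * y₀ ^ 2 / 2 := by linear_combination -p₂ / 2
    have hz₂ : z₂ = -(c * x₀ ^ 2 / 2) := by linear_combination q₂ / 2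
    subst hx₂ hy₂ hz₂
    obtain ⟨-, s₂, s₃⟩ := hcl (-(x₀ * y₀)) (x₀ ^ 2) (-y₀ ^ 2) (by module)
    have s₂ : x₀ = 0 := by simpa using s₂
    have s₃ : y₀ = 0 := by simpa using s₃
    have := hcl 1 0 0 (by simp [s₂, s₃])
    simp at this
  · have hx₂ : x₂ = 0 := by linear_combination -r₂
    have hy₂ : y₂ = 0 := by linear_combination -p₂ / 2
    have hz₂ : z₂ = 0 := by linear_combination q₂ / 2
    subst hx₂ hy₂ hz₂
    obtain ⟨α, β, γ, hu⟩ := hspan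
    have := hli' (α * x₀ + β * y₀ + γ * z₀) (α * x₁ + β * y₁ + γ * z₁) (-1)
      (by linear_combination (norm := module) -hu)
    simp at this

open IsSl2Triple in
theorem nonempty_lieEquiv_of_primitive (hc : IsSl2CrossedHom H E F X Y Z)
    (hn : finrank ℂ n = 3) (t : IsSl2Triple H E F) {m : ℕ} {v : n} (hm : m ≠ 0)
    (hv : HasPrimitiveVectorWith t v (m : ℂ)) : Nonempty (n ≃ₗ⁅ℂ⁆ sl (Fin 2) ℂ) := by
  have : FiniteDimensional ℂ n := .of_finrank_pos (by omega)
  have hH (i : ℕ) : H ((F ^ i) v) = ((m : ℂ) - 2 * i) • (F ^ i) v := hv.lie_h_pow_toEnd_f i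
  have hE (i : ℕ) : E ((F ^ (i + 1)) v) = ((i + 1) * ((m : ℂ) - i)) • (F ^ i) v :=
    hv.lie_e_pow_succ_toEnd_f i
  have hE₀ : E v = 0 := hv.lie_e
  have hF (i : ℕ) : F ((F ^ i) v) = (F ^ (i + 1)) v := hv.lie_f_pow_toEnd_f i
  have htop : (F ^ (m + 1)) v = 0 := hv.pow_toEnd_f_eq_zero_of_eq_nat rfl
  have hne {i : ℕ} (hi : i ≤ m) : (F ^ i) v ≠ 0 := hv.pow_toEnd_f_ne_zero_of_eq_nat rfl hi
  have hli : LinearIndependent ℂ fun i : Fin (m + 1) ↦ (F ^ (i : ℕ)) v := by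
    refine End.eigenvectors_linearIndependent' H (fun i : Fin (m + 1) ↦ (m : ℂ) - 2 * (i : ℕ))
      (fun i j hij ↦ ?_) _ fun i ↦ ⟨End.mem_eigenspace_iff.mpr (hH i), hne (by omega)⟩
    simpa [Fin.val_inj] using hij
  have hm3 : m + 1 ≤ 3 := by simpa [hn] using hli.fintype_card_le_finrank
  obtain rfl | rfl : m = 2 ∨ m = 1 := by omega
  · refine hc.nonempty_lieEquiv_of_adjoint hn (v₀ := v) (v₁ := F v) (v₂ := (F ^ 2) v) ?_ ?_ ?_ ?_
      hE₀ ?_ ?_ rfl ?_ ?_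
    · convert hli using 1
      funext i
      fin_cases i <;> simp
    · simpa using hH 0
    · simpa using hH 1
    · convert hH 2 using 2
      norm_num
    · simpa using hE 0
    · convert hE 1 using 1
      norm_num
    · simpa using hF 1
    · simpa using (hF 2).trans htop
  · exfalso
    have hli₂ : LinearIndependent ℂ ![v, F v] := by
      convert hli using 1
      funext i
      fin_cases i <;> simp
    have hH₀ : H v = v := by simpa using hH 0
    have hH₁ : H (F v) = -F v := by
      have := hH 1
      norm_num at this
      simpa using this
    have hE₁ : E (F v) = v := by simpa using hE 0
    have hF₁ : F (F v) = 0 := by simpa using (hF 1).trans htop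
    obtain ⟨w, hw⟩ : ∃ w, w ∉ Submodule.span ℂ (Set.range ![v, F v]) := by
      by_contra! hall
      have := (finrank_range_le_card (R := ℂ) ![v, F v])
      rw [Set.finrank, (Submodule.eq_top_iff'.mpr hall), finrank_top, hn] at this
      simp at this
    have hliw : LinearIndependent ℂ ![v, F v, w] := by
      have := linearIndependent_finSnoc.mpr ⟨hli₂, hw⟩
      have hsnoc : (Fin.snoc ![v, F v] w : Fin 3 → n) = ![v, F v, w] := by
        funext i
        fin_cases i <;> rfl
      exact hsnoc ▸ this
    obtain ⟨a, b, c, hHw⟩ := exists_smul_add_eq hn hliw (H w)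
    obtain ⟨a₁, b₁, c₁, hEw⟩ := exists_smul_add_eq hn hliw (E w)
    obtain ⟨a₂, b₂, c₂, hFw⟩ := exists_smul_add_eq hn hliw (F w)
    have hHEF (x : n) : E (F x) - F (E x) = H x := by
      simpa [Ring.lie_def] using LinearMap.congr_fun t.lie_e_f x
    have hHE (x : n) : H (E x) - E (H x) = (2 : ℂ) • E x := by
      simpa [Ring.lie_def] using LinearMap.congr_fun (t.lie_h_e_smul ℂ) x
    have hHF (x : n) : H (F x) - F (H x) = -((2 : ℂ) • F x) := by
      simpa [Ring.lie_def] using LinearMap.congr_fun (t.lie_lie_smul_f ℂ) x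
    have hc0 : c = 0 := by
      have := hHEF w
      simp only [hHw, hEw, hFw, map_add, map_smul, hE₀, hE₁, hF₁] at this
      have := linearIndependent_triple_iff.mp hliw (b₂ + c₂ * a₁ - c₁ * a₂ - a)
        (c₂ * b₁ - a₁ - c₁ * b₂ - b) (-c) (by linear_combination (norm := module) this)
      simpa using this.2.2
    obtain ⟨u, hu⟩ : ∃ u, u = w - a • v + b • F v := ⟨_, rfl⟩
    have hliu : LinearIndependent ℂ ![v, F v, u] := by
      rw [linearIndependent_triple_iff] at hliw ⊢
      intro p q r h
      rw [hu] at h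
      obtain ⟨h₁, h₂, h₃⟩ := hliw (p - r * a) (q + r * b) r
        (by linear_combination (norm := module) h)
      subst h₃
      exact ⟨by simpa using h₁, by simpa using h₂, rfl⟩
    have hHu : H u = 0 := by
      rw [hu]
      simp only [map_add, map_sub, map_smul, hHw, hH₀, hH₁, hc0]
      module
    have hEu : E u = 0 := by
      obtain ⟨p, q, r, h⟩ := exists_smul_add_eq hn hliu (E u)
      have := hHE u
      simp only [hHu, h, map_add, map_smul, hH₀, hH₁, map_zero] at this
      obtain ⟨h₁, h₂, h₃⟩ := linearIndependent_triple_iff.mp hliu p (3 * q) (2 * r)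
        (by linear_combination (norm := module) -this)
      rw [h, h₁, (mul_eq_zero_iff_left three_ne_zero).mp h₂,
        (mul_eq_zero_iff_left two_ne_zero).mp h₃]
      simp
    have hFu : F u = 0 := by
      obtain ⟨p, q, r, h⟩ := exists_smul_add_eq hn hliu (F u)
      have := hHF u
      simp only [hHu, h, map_add, map_smul, hH₀, hH₁, map_zero] at this
      obtain ⟨h₁, h₂, h₃⟩ := linearIndependent_triple_iff.mp hliu (3 * p) q (2 * r)
        (by linear_combination (norm := module) this)
      rw [h, h₂, (mul_eq_zero_iff_left three_ne_zero).mp h₁,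
        (mul_eq_zero_iff_left two_ne_zero).mp h₃]
      simp
    exact hc.false_of_natural_add_trivial hn hliu hH₀ hH₁ hHu hE₀ hE₁ hEu rfl hF₁ hFu

theorem nonempty_lieEquiv (hc : IsSl2CrossedHom H E F X Y Z)
    (hn : finrank ℂ n = 3) (hHEF : ⁅E, F⁆ = H) (hHE : ⁅H, E⁆ = 2 • E) (hHF : ⁅H, F⁆ = -(2 • F)) :
    Nonempty (n ≃ₗ⁅ℂ⁆ sl (Fin 2) ℂ) := by
  have : FiniteDimensional ℂ n := .of_finrank_pos (by omega)
  by_cases hH : H = 0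
  · have hE : E = 0 := by
      rw [hH, zero_lie, eq_comm, ← Nat.cast_smul_eq_nsmul ℂ] at hHE
      exact (smul_eq_zero.mp hHE).resolve_left (by norm_num)
    have hF : F = 0 := by
      rw [hH, zero_lie, eq_comm, neg_eq_zero, ← Nat.cast_smul_eq_nsmul ℂ] at hHF
      exact (smul_eq_zero.mp hHF).resolve_left (by norm_num)
    have h₁ := hc.lie_h_e
    have h₂ := hc.lie_h_f
    have h₃ := hc.lie_e_f
    simp only [hH, hE, hF, LinearMap.zero_apply, sub_zero, zero_add] at h₁ h₂ h₃
    refine IsSl2Triple.nonempty_lieEquiv (h := X) (e := Y) (f := Z)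
      ⟨hc.linearIndependent.ne_zero 0, h₃, ?_, ?_⟩ isSl2Triple_sl_two hn finrank_sl_two
      hc.linearIndependent linearIndependent_sl_two
    · rw [h₁, two_smul, two_smul]
    · rw [h₂, neg_smul, two_smul, two_smul]
  · have t : IsSl2Triple H E F := ⟨hH, hHEF, hHE, hHF⟩
    obtain ⟨m, v, hm, hv⟩ | ⟨m, v, hm, hv⟩ := t.exists_primitive_pos
    · exact hc.nonempty_lieEquiv_of_primitive hn t hm hv
    · exact hc.symm.nonempty_lieEquiv_of_primitive hn t.symm hm hv

end IsSl2CrossedHom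

/-- Corollary 4.5: if there exists a post-Lie algebra structure on `(g,n)` with
`g ≅ sl₂(ℂ)`, then `n ≅ sl₂(ℂ)`. -/
theorem n_sl2_of_postLie_g_sl2 {g n : Type*}
    [LieRing g] [LieAlgebra ℂ g] [LieRing n] [LieAlgebra ℂ n]
    [FiniteDimensional ℂ n] (e : g ≃ₗ[ℂ] n)
    (hg : Nonempty (g ≃ₗ⁅ℂ⁆ LieAlgebra.SpecialLinear.sl (Fin 2) ℂ))
    (h : ∃ P : n →ₗ[ℂ] n →ₗ[ℂ] n, IsPostLiePair e P) :
    Nonempty (n ≃ₗ⁅ℂ⁆ LieAlgebra.SpecialLinear.sl (Fin 2) ℂ) := by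
  obtain ⟨φ⟩ := hg
  obtain ⟨P, hP₁, hP₂, hP₃⟩ := h
  let ψ : sl (Fin 2) ℂ ≃ₗ[ℂ] n := φ.symm.toLinearEquiv.trans e
  have hψ (x y : sl (Fin 2) ℂ) : ψ ⁅x, y⁆ = e ⁅e.symm (ψ x), e.symm (ψ y)⁆ := by
    simpa [ψ] using φ.symm.map_lie x y
  have hcross (x y : sl (Fin 2) ℂ) :
      P (ψ x) (ψ y) - P (ψ y) (ψ x) + ⁅ψ x, ψ y⁆ = ψ ⁅x, y⁆ := by
    rw [hP₁, hψ, sub_add_cancel]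
  have hrep (x y : sl (Fin 2) ℂ) : ⁅P (ψ x), P (ψ y)⁆ = P (ψ ⁅x, y⁆) := by
    ext z
    rw [hψ, hP₂]
    rfl
  have t := isSl2Triple_sl_two
  have hn : finrank ℂ n = 3 := ψ.finrank_eq ▸ finrank_sl_two
  refine IsSl2CrossedHom.nonempty_lieEquiv (X := ψ (singleSubSingle 0 1 1))
    (Y := ψ (single 0 1 (by decide) 1)) (Z := ψ (single 1 0 (by decide) 1))
    ⟨hP₃ _, hP₃ _, hP₃ _, ?_, ?_, ?_, ?_⟩ hn
    ((hrep _ _).trans (by rw [t.lie_e_f])) ((hrep _ _).trans (by rw [t.lie_h_e_nsmul]; simp))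
    ((hrep _ _).trans (by rw [t.lie_h_f_nsmul]; simp))
  · rw [hcross, t.lie_h_e_smul ℂ, map_smul]
  · rw [hcross, t.lie_lie_smul_f ℂ, map_neg, map_smul, neg_smul]
  · rw [hcross, t.lie_e_f]
  · rw [linearIndependent_triple_iff]
    intro a b c h
    refine linearIndependent_triple_iff.mp linearIndependent_sl_two a b c (ψ.injective ?_)
    simpa only [map_add, map_smul, map_zero] using h
end

section
/- Let x·y be a post-Lie algebra structure on a pair of complex Lie algebras (g,n), where g is simple and n is semisimple. Then n is simple, and either x·y = 0 for all x,y (in which case [x,y] = {x,y} for all x,y), or x·y = [x,y] = −{x,y} for all x,y. -/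
section Grading

variable {K L ι : Type*} [Field K] [LieRing L] [LieAlgebra K L] {V : ι → Submodule K L}

/-- If `V` is an independent family of submodules and a smaller family `W` spans everything, then
`W = V`. -/
lemma iSupIndep.le_of_le_of_iSup_eq_top {K M ι : Type*} [Ring K] [AddCommGroup M] [Module K M]
    {V W : ι → Submodule K M} (hV : iSupIndep V) (hWV : W ≤ V) (hW : ⨆ i, W i = ⊤) : V ≤ W := by
  intro i
  have hsup : W i ⊔ ⨆ (j) (_ : j ≠ i), W j = ⊤ := by
    rw [eq_top_iff, ← hW]
    refine iSup_le fun j ↦ ?_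
    by_cases h : j = i
    · subst h; exact le_sup_left
    · exact le_sup_of_le_right (le_iSup₂_of_le j h le_rfl)
  have hdisj : (⨆ (j) (_ : j ≠ i), W j) ⊓ V i = ⊥ := by
    rw [eq_bot_iff, ← (hV i).eq_bot, inf_comm]
    exact inf_le_inf le_rfl (iSup₂_mono fun j _ ↦ hWV j)
  have := sup_inf_assoc_of_le (⨆ (j) (_ : j ≠ i), W j) (hWV i)
  rw [hsup, hdisj, top_inf_eq, sup_bot_eq] at this
  exact this.le

variable [Mul ι] {κ : ι → ℝ}

/-- Let `V` be a grading of a perfect Lie algebra and `κ` an additive map to the circle, represented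
by numbers in `(0, 1)`. If the components with `κ ≥ k` generate, so do those with `κ > k`. -/
lemma LieSubalgebra.lieSpan_lt_eq_top_of_lieSpan_le_eq_top
    (hlie : ∀ i j, ∀ x ∈ V i, ∀ y ∈ V j, ⁅x, y⁆ ∈ V (i * j))
    (hind : iSupIndep V) (htop : ⨆ i, V i = ⊤)
    (hpos : ∀ i, V i ≠ ⊥ → 0 < κ i) (hlt : ∀ i, V i ≠ ⊥ → κ i < 1)
    (hadd : ∀ i j, V i ≠ ⊥ → V j ≠ ⊥ → V (i * j) ≠ ⊥ →
      κ (i * j) = κ i + κ j ∨ κ (i * j) = κ i + κ j - 1)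
    (hperf : ⁅(⊤ : LieIdeal K L), (⊤ : LieIdeal K L)⁆ = ⊤) {k : ℝ}
    (hk : LieSubalgebra.lieSpan K L {x | ∃ i, k ≤ κ i ∧ x ∈ V i} = ⊤) :
    LieSubalgebra.lieSpan K L {x | ∃ i, k < κ i ∧ x ∈ V i} = ⊤ := by
  classical
  set S := LieSubalgebra.lieSpan K L {x | ∃ i, k < κ i ∧ x ∈ V i}
  have memS : ∀ i, k < κ i → ∀ x ∈ V i, x ∈ S := fun i hi x hx ↦
    LieSubalgebra.subset_lieSpan ⟨i, hi, hx⟩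
  let W : ι → Submodule K L := fun i ↦ if κ i = k then V i ⊓ S.toSubmodule else V i
  have hWV : W ≤ V := by
    intro i
    by_cases h : κ i = k
    · simp [W, h]
    · simp [W, h]
  have memW : ∀ i, ∀ x ∈ V i, (κ i = k → x ∈ S) → x ∈ ⨆ i, W i := by
    intro i x hx h
    refine Submodule.mem_iSup_of_mem i ?_
    by_cases h' : κ i = k
    · simpa [W, h'] using ⟨hx, h h'⟩
    · simpa [W, h'] using hx
  have memW' : ∀ i j, ∀ x ∈ V i, ∀ y ∈ V j,
      (0 < κ i → 0 < κ j → κ i < 1 → κ j < 1 → κ (i * j) = k →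
        (κ i + κ j = k ∨ κ i + κ j - 1 = k) → ⁅x, y⁆ ∈ S) → ⁅x, y⁆ ∈ ⨆ i, W i := by
    intro i j x hx y hy h
    by_cases hi : V i = ⊥
    · have : x = 0 := by simpa [hi] using hx
      simp [this]
    by_cases hj : V j = ⊥
    · have : y = 0 := by simpa [hj] using hy
      simp [this]
    by_cases hij : V (i * j) = ⊥
    · have : ⁅x, y⁆ = 0 := by simpa [hij] using hlie i j x hx y hy
      simp [this]
    refine memW _ _ (hlie i j x hx y hy) fun hkk ↦
      h (hpos i hi) (hpos j hj) (hlt i hi) (hlt j hj) hkk ?_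
    rw [← hkk]
    exact (hadd i j hi hj hij).imp Eq.symm Eq.symm
  have hW : ∀ y x : L, x ∈ ⨆ i, W i → ⁅x, y⁆ ∈ ⨆ i, W i := by
    intro y
    have hy : y ∈ LieSubalgebra.lieSpan K L {x | ∃ i, k ≤ κ i ∧ x ∈ V i} := by simp [hk]
    induction hy using LieSubalgebra.lieSpan_induction with
    | mem y hy =>
      obtain ⟨j, hj, hy⟩ := hy
      intro x hx
      induction hx using Submodule.iSup_induction' with
      | mem i x hx =>
        refine memW' i j x (hWV i hx) y hy fun hi0 hj0 hi1 hj1 hij hor ↦ ?_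
        rcases lt_trichotomy (κ i) k with hi | hi | hi
        · rcases hor with h | h <;> linarith
        · rcases hor with h | h <;> linarith
        · have hj' : k < κ j := by rcases hor with h | h <;> linarith
          exact S.lie_mem (memS i hi x (hWV i hx)) (memS j hj' y hy)
      | zero => simp
      | add x x' _ _ hx hx' => rw [add_lie]; exact add_mem hx hx'
    | zero => simp
    | add y y' _ _ hy hy' =>
      intro x hx
      rw [lie_add]
      exact add_mem (hy x hx) (hy' x hx)
    | smul a y _ hy =>
      intro x hx
      rw [lie_smul]
      exact Submodule.smul_mem _ _ (hy x hx)
    | lie y y' _ _ hy hy' =>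
      intro x hx
      rw [leibniz_lie, ← lie_skew y ⁅x, y'⁆, ← sub_eq_add_neg]
      exact sub_mem (hy' _ (hy x hx)) (hy _ (hy' x hx))
  have hW' : ∀ y x : L, x ∈ ⨆ i, W i → ⁅y, x⁆ ∈ ⨆ i, W i := by
    intro y x hx
    rw [← lie_skew]
    exact neg_mem (hW y x hx)
  have hder : ∀ x y : L, ⁅x, y⁆ ∈ ⨆ i, W i := by
    intro x y
    have hx : x ∈ ⨆ i, V i := by simp [htop]
    have hy : y ∈ ⨆ i, V i := by simp [htop]
    induction hx using Submodule.iSup_induction' with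
    | zero => simp
    | add x x' _ _ hx hx' => rw [add_lie]; exact add_mem hx hx'
    | mem i x hx =>
      induction hy using Submodule.iSup_induction' with
      | zero => simp
      | add x x' _ _ hx hx' => rw [lie_add]; exact add_mem hx hx'
      | mem j y hy =>
        by_cases hi : κ i = k
        · by_cases hj : κ j = k
          · refine memW' i j x hx y hy fun hi0 hj0 hi1 hj1 hij hor ↦ ?_
            rcases hor with h | h <;> linarith
          · exact hW' _ _ (memW j y hy fun h ↦ absurd h hj)
        · exact hW _ _ (memW i x hx fun h ↦ absurd h hi)
  let I : LieIdeal K L := { (⨆ i, W i) with lie_mem := fun {_ _} _ ↦ hder _ _ }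
  have hI : ⨆ i, W i = ⊤ := by
    have : ⁅(⊤ : LieIdeal K L), (⊤ : LieIdeal K L)⁆ ≤ I :=
      (LieSubmodule.lie_le_iff _ _ _).2 fun x _ y _ ↦ hder x y
    rw [hperf] at this
    rw [eq_top_iff]
    intro x _
    exact this (LieSubmodule.mem_top x)
  have hVW := hind.le_of_le_of_iSup_eq_top hWV hI
  rw [eq_top_iff, ← hk, LieSubalgebra.lieSpan_le]
  rintro x ⟨i, hi, hx⟩
  rcases hi.lt_or_eq with hi | hi
  · exact memS i hi x hx
  · have := hVW i hx
    simp only [W, hi, if_true] at this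
    exact this.2

/-- A version of Kreknin's theorem: a perfect Lie algebra graded by a circle, with finite support
not containing the identity, is trivial. -/
lemma LieAlgebra.subsingleton_of_perfect_of_grading
    (hlie : ∀ i j, ∀ x ∈ V i, ∀ y ∈ V j, ⁅x, y⁆ ∈ V (i * j))
    (hind : iSupIndep V) (htop : ⨆ i, V i = ⊤) (hfin : {i | V i ≠ ⊥}.Finite)
    (hpos : ∀ i, V i ≠ ⊥ → 0 < κ i) (hlt : ∀ i, V i ≠ ⊥ → κ i < 1)
    (hadd : ∀ i j, V i ≠ ⊥ → V j ≠ ⊥ → V (i * j) ≠ ⊥ →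
      κ (i * j) = κ i + κ j ∨ κ (i * j) = κ i + κ j - 1)
    (hperf : ⁅(⊤ : LieIdeal K L), (⊤ : LieIdeal K L)⁆ = ⊤) : Subsingleton L := by
  classical
  have key : ∀ (s : Finset ι) (k : ℝ), hfin.toFinset.filter (k < κ ·) = s →
      LieSubalgebra.lieSpan K L {x | ∃ i, k < κ i ∧ x ∈ V i} = ⊤ → Subsingleton L := by
    intro s
    induction s using Finset.strongInduction with
    | H s ih =>
      intro k hs hk
      rcases s.eq_empty_or_nonempty with rfl | hne
      · have hbot : LieSubalgebra.lieSpan K L {x | ∃ i, k < κ i ∧ x ∈ V i} = ⊥ := by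
          rw [eq_bot_iff, LieSubalgebra.lieSpan_le]
          rintro x ⟨i, hi, hx⟩
          by_cases hVi : V i = ⊥
          · simpa [hVi] using hx
          · have : i ∈ hfin.toFinset.filter (k < κ ·) := by simp [hVi, hi]
            simp [hs] at this
        refine subsingleton_of_forall_eq 0 fun x ↦ ?_
        have : x ∈ (⊤ : LieSubalgebra K L) := LieSubalgebra.mem_top x
        rw [← hk, hbot] at this
        exact (LieSubalgebra.mem_bot x).1 this
      · obtain ⟨i₀, hi₀, hmin⟩ := s.exists_min_image κ hne
        have hki₀ : k < κ i₀ := by rw [← hs] at hi₀; exact (Finset.mem_filter.1 hi₀).2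
        refine ih (hfin.toFinset.filter (κ i₀ < κ ·)) ?_ (κ i₀) rfl ?_
        · refine (Finset.ssubset_iff_of_subset ?_).2 ⟨i₀, hi₀, by simp⟩
          intro i hi
          rw [← hs]
          simp only [Finset.mem_filter] at hi ⊢
          exact ⟨hi.1, hki₀.trans hi.2⟩
        · refine LieSubalgebra.lieSpan_lt_eq_top_of_lieSpan_le_eq_top
            hlie hind htop hpos hlt hadd hperf ?_
          rw [eq_top_iff, ← hk, LieSubalgebra.lieSpan_le]
          rintro x ⟨i, hi, hx⟩
          by_cases hVi : V i = ⊥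
          · have : x = 0 := by simpa [hVi] using hx
            simp [this]
          · exact LieSubalgebra.subset_lieSpan
              ⟨i, hmin i (by rw [← hs]; simp [hVi, hi]), hx⟩
  refine key _ 0 rfl ?_
  rw [← LieSubalgebra.toSubmodule_inj, LieSubalgebra.top_toSubmodule, eq_top_iff, ← htop]
  refine iSup_le fun i x hx ↦ ?_
  by_cases hVi : V i = ⊥
  · have : x = 0 := by simpa [hVi] using hx
    simp [this]
  · exact LieSubalgebra.subset_lieSpan ⟨i, hpos i hVi, hx⟩

end Grading

/-- Generalized eigenspaces of a Lie algebra endomorphism form a multiplicative grading. -/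
lemma LieHom.lie_mem_maxGenEigenspace {K L : Type*} [Field K] [LieRing L] [LieAlgebra K L]
    (f : L →ₗ⁅K⁆ L) {a b : K} {x y : L}
    (hx : x ∈ Module.End.maxGenEigenspace (f : L →ₗ[K] L) a)
    (hy : y ∈ Module.End.maxGenEigenspace (f : L →ₗ[K] L) b) :
    ⁅x, y⁆ ∈ Module.End.maxGenEigenspace (f : L →ₗ[K] L) (a * b) := by
  set F : Module.End K L := (f : L →ₗ[K] L) with hF
  rw [Module.End.mem_maxGenEigenspace] at hx hy ⊢
  obtain ⟨p, hp⟩ := hx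
  obtain ⟨q, hq⟩ := hy
  refine ⟨p + q, ?_⟩
  induction p generalizing x y q with
  | zero => simp_all
  | succ p ihp =>
    induction q generalizing x y with
    | zero => simp_all
    | succ q ihq =>
      have step : (F - (a * b) • 1) ⁅x, y⁆ =
          ⁅(F - a • 1) x, F y⁆ + a • ⁅x, (F - b • 1) y⁆ := by
        simp [hF, mul_smul, smul_sub]
      have hFy : ((F - b • 1) ^ (q + 1)) (F y) = 0 := by
        have hc : Commute ((F - b • 1) ^ (q + 1)) F :=
          (((Commute.refl F).sub_left ((Commute.one_left F).smul_left b))).pow_left _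
        have := congrArg (fun G : Module.End K L ↦ G y) hc.eq
        simp only [Module.End.mul_apply] at this
        rw [this, hq, map_zero]
      have h1 := ihp (x := (F - a • 1) x) (y := F y) (q := q + 1)
        (by rwa [← Module.End.mul_apply, ← pow_succ]) hFy
      have h2 := ihq (x := x) (y := (F - b • 1) y) hp
        (by rwa [← Module.End.mul_apply, ← pow_succ])
      rw [show p + 1 + (q + 1) = (p + 1 + q) + 1 by ring, pow_succ, Module.End.mul_apply, step,
        map_add, map_smul, h2, smul_zero, add_zero, show p + 1 + q = p + (q + 1) by ring, h1]

/-- Finitely many nonzero complex numbers other than `1` can be mapped to nontrivial elements of the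
circle by a common homomorphism. -/
lemma Complex.exists_arg_add_log_norm_notMem_int {s : Set ℂ} (hs : s.Finite) (h0 : 0 ∉ s)
    (h1 : 1 ∉ s) :
    ∃ ε : ℝ, ∀ z ∈ s, ∀ m : ℤ, z.arg / (2 * Real.pi) + ε * Real.log ‖z‖ ≠ m := by
  have hc : (⋃ z ∈ s, ⋃ m : ℤ,
      {ε : ℝ | z.arg / (2 * Real.pi) + ε * Real.log ‖z‖ = m}).Countable := by
    refine hs.countable.biUnion fun z hz ↦ Set.countable_iUnion fun m ↦ Set.Subsingleton.countable ?_
    intro ε hε δ hδ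
    simp only [Set.mem_ofPred_eq] at hε hδ
    by_cases hlog : Real.log ‖z‖ = 0
    · exfalso
      have hz0 : z ≠ 0 := fun h ↦ h0 (h ▸ hz)
      have hnorm : ‖z‖ = 1 := Real.eq_one_of_pos_of_log_eq_zero (norm_pos_iff.2 hz0) hlog
      rw [hlog, mul_zero, add_zero, div_eq_iff (by positivity)] at hε
      have hexp := Complex.norm_mul_exp_arg_mul_I z
      rw [hε, hnorm] at hexp
      have : Complex.exp (((m * (2 * Real.pi) : ℝ) : ℂ) * Complex.I) = 1 := by
        rw [Complex.exp_eq_one_iff]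
        exact ⟨m, by push_cast; ring⟩
      rw [this] at hexp
      exact h1 (by simpa [← hexp] using hz)
    · exact mul_right_cancel₀ hlog (by linarith)
  obtain ⟨ε, hε⟩ : ∃ ε, ε ∉ (⋃ z ∈ s, ⋃ m : ℤ,
      {ε : ℝ | z.arg / (2 * Real.pi) + ε * Real.log ‖z‖ = m}) := by
    by_contra! h
    exact Cardinal.not_countable_real (by rwa [Set.eq_univ_of_forall h] at hc)
  exact ⟨ε, fun z hz m h ↦ hε (Set.mem_biUnion hz (Set.mem_iUnion.2 ⟨m, h⟩))⟩

/-- An injective endomorphism of a nontrivial perfect complex Lie algebra has a nonzero fixed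
point. -/
lemma LieHom.exists_fixed_ne_zero_of_perfect {L : Type*} [LieRing L] [LieAlgebra ℂ L]
    [FiniteDimensional ℂ L] [Nontrivial L]
    (hperf : ⁅(⊤ : LieIdeal ℂ L), (⊤ : LieIdeal ℂ L)⁆ = ⊤)
    (f : L →ₗ⁅ℂ⁆ L) (hf : Function.Injective f) : ∃ x ≠ 0, f x = x := by
  by_contra! hfix
  set F : Module.End ℂ L := (f : L →ₗ[ℂ] L) with hF
  have hV : ∀ a, F.maxGenEigenspace a ≠ ⊥ → ∃ x ≠ 0, f x = a • x := by
    intro a ha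
    by_contra! h
    refine ha ((Submodule.eq_bot_iff _).2 fun x hx ↦ ?_)
    obtain ⟨p, hp⟩ := (Module.End.mem_maxGenEigenspace _ _ _).1 hx
    have hinj : Function.Injective (F - a • (1 : Module.End ℂ L)) := by
      rw [injective_iff_map_eq_zero]
      intro y hy
      by_contra hy0
      exact h y hy0 (by simpa [hF, sub_eq_zero] using hy)
    have hinj' : Function.Injective ((F - a • (1 : Module.End ℂ L)) ^ p) := by
      rw [Module.End.coe_pow]
      exact hinj.iterate p
    exact hinj' (by rw [hp, map_zero])
  have hfin : {a | F.maxGenEigenspace a ≠ ⊥}.Finite :=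
    WellFoundedGT.finite_ne_bot_of_iSupIndep F.independent_maxGenEigenspace
  have hV0 : ∀ a, F.maxGenEigenspace a ≠ ⊥ → a ≠ 0 := by
    rintro a ha rfl
    obtain ⟨x, hx, hfx⟩ := hV _ ha
    exact hx (hf (by simpa using hfx))
  obtain ⟨ε, hε⟩ := Complex.exists_arg_add_log_norm_notMem_int hfin
    (fun h ↦ hV0 _ h rfl) (fun h ↦ by
      obtain ⟨x, hx, hfx⟩ := hV _ h
      exact hfix x hx (by simpa using hfx))
  let g : ℂ → ℝ := fun z ↦ z.arg / (2 * Real.pi) + ε * Real.log ‖z‖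
  have hg : ∀ a b : ℂ, a ≠ 0 → b ≠ 0 → ∃ m : ℤ, g (a * b) = g a + g b + m := by
    intro a b ha hb
    have harg := Complex.arg_mul_coe_angle ha hb
    rw [← Real.Angle.coe_add, Real.Angle.angle_eq_iff_two_pi_dvd_sub] at harg
    obtain ⟨m, hm⟩ := harg
    refine ⟨m, ?_⟩
    simp only [g]
    rw [norm_mul, Real.log_mul (norm_ne_zero_iff.2 ha) (norm_ne_zero_iff.2 hb),
      sub_eq_iff_eq_add.1 hm]
    field_simp
    ring
  have hsub : Subsingleton L := LieAlgebra.subsingleton_of_perfect_of_grading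
    (κ := fun a ↦ Int.fract (g a)) (V := F.maxGenEigenspace)
    (fun i j x hx y hy ↦ f.lie_mem_maxGenEigenspace hx hy)
    F.independent_maxGenEigenspace F.iSup_maxGenEigenspace_eq_top hfin
    (fun a ha ↦ by
      refine (Int.fract_nonneg _).lt_of_ne fun h ↦ hε a ha ⌊g a⌋ ?_
      have := Int.self_sub_floor (g a)
      exact sub_eq_zero.1 (this.trans h.symm))
    (fun a _ ↦ Int.fract_lt_one _)
    (fun a b ha hb _ ↦ by
      obtain ⟨m, hm⟩ := hg a b (hV0 a ha) (hV0 b hb)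
      rw [hm, Int.fract_add_intCast]
      obtain ⟨l, hl⟩ := Int.fract_add (g a) (g b)
      have h1 := Int.fract_nonneg (g a + g b)
      have h2 := Int.fract_lt_one (g a + g b)
      have h3 := Int.fract_nonneg (g a)
      have h4 := Int.fract_lt_one (g a)
      have h5 := Int.fract_nonneg (g b)
      have h6 := Int.fract_lt_one (g b)
      have h7 : (l : ℝ) < 1 := by linarith
      have h8 : (-2 : ℝ) < l := by linarith
      have h9 : l < 1 := by exact_mod_cast h7
      have h10 : -2 < l := by exact_mod_cast h8
      obtain rfl | rfl : l = 0 ∨ l = -1 := by omega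
      · left; push_cast at hl; linarith
      · right; push_cast at hl; linarith)
    hperf
  exact not_subsingleton L hsub

/-- A simple Lie algebra is perfect. -/
lemma LieAlgebra.IsSimple.lie_top_top_eq_top (K L : Type*) [CommRing K] [LieRing L]
    [LieAlgebra K L] [LieAlgebra.IsSimple K L] :
    ⁅(⊤ : LieIdeal K L), (⊤ : LieIdeal K L)⁆ = ⊤ := by
  refine (LieAlgebra.IsSimple.eq_bot_or_eq_top _).resolve_left fun h ↦ ?_
  refine LieAlgebra.IsSimple.non_abelian K (L := L) ⟨fun x y ↦ ?_⟩
  have := LieSubmodule.lie_mem_lie (LieSubmodule.mem_top (R := K) (L := L) x)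
    (LieSubmodule.mem_top (R := K) (L := L) y)
  rwa [h, LieSubmodule.mem_bot] at this

/-- Simplicity is invariant under Lie algebra isomorphisms. -/
lemma LieAlgebra.IsSimple.of_equiv {K L L' : Type*} [CommRing K] [LieRing L]
    [LieAlgebra K L] [LieRing L'] [LieAlgebra K L'] [LieAlgebra.IsSimple K L] (e : L ≃ₗ⁅K⁆ L') :
    LieAlgebra.IsSimple K L' where
  eq_bot_or_eq_top I := by
    refine (LieAlgebra.IsSimple.eq_bot_or_eq_top (R := K) (LieIdeal.comap e.toLieHom I)).imp
      (fun h ↦ ?_) (fun h ↦ ?_)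
    · refine (LieSubmodule.eq_bot_iff _).2 fun x hx ↦ ?_
      have : e.symm x ∈ LieIdeal.comap e.toLieHom I := by simpa [LieIdeal.mem_comap] using hx
      rw [h, LieSubmodule.mem_bot] at this
      simpa using congrArg e this
    · refine eq_top_iff.2 fun x _ ↦ ?_
      have : e.symm x ∈ LieIdeal.comap e.toLieHom I := by simp [h]
      simpa [LieIdeal.mem_comap] using this
  non_abelian h := LieAlgebra.IsSimple.non_abelian K (L := L)
    ⟨fun x y ↦ e.injective ((e.map_lie x y).trans ((h.trivial _ _).trans (map_zero e).symm))⟩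

/-- A homomorphism out of a simple Lie algebra is zero or injective. -/
lemma LieAlgebra.IsSimple.eq_zero_or_injective {K L L' : Type*} [CommRing K] [LieRing L]
    [LieAlgebra K L] [LieRing L'] [LieAlgebra K L'] [LieAlgebra.IsSimple K L] (f : L →ₗ⁅K⁆ L') :
    (∀ x, f x = 0) ∨ Function.Injective f := by
  rcases LieAlgebra.IsSimple.eq_bot_or_eq_top (R := K) f.ker with h | h
  · exact .inr ((LieHom.ker_eq_bot f).1 h)
  · exact .inl fun x ↦ by rw [← LieHom.mem_ker, h]; exact LieSubmodule.mem_top x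

/-- A post-Lie product on `(g, n)` with every derivation of `n` inner and `n` centerless is given by
a homomorphism `φ : g → n` such that `φ + e` is a homomorphism too. -/
lemma IsPostLiePair.exists_lieHom {K g n : Type*} [Field K] [LieRing g] [LieAlgebra K g]
    [LieRing n] [LieAlgebra K n] [FiniteDimensional K n] [LieAlgebra.IsKilling K n]
    {e : g ≃ₗ[K] n} {P : n →ₗ[K] n →ₗ[K] n} (hP : IsPostLiePair e P) :
    ∃ φ ψ : g →ₗ⁅K⁆ n, (∀ x y, P (e x) y = ⁅φ x, y⁆) ∧ ∀ x, ψ x = φ x + e x := by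
  obtain ⟨h1, h2, h3⟩ := hP
  have hinj : ∀ a b : n, (∀ y : n, ⁅a, y⁆ = ⁅b, y⁆) → a = b := by
    intro a b hab
    have : a - b ∈ LieAlgebra.center K n := by
      rw [LieModule.mem_maxTrivSubmodule]
      intro y
      rw [← lie_skew, sub_lie, hab, sub_self, neg_zero]
    rw [LieAlgebra.center_eq_bot, LieSubmodule.mem_bot] at this
    exact sub_eq_zero.1 this
  have hex : ∀ x : g, ∃ a : n, ∀ y, P (e x) y = ⁅a, y⁆ := by
    intro x
    let D : LieDerivation K n n :=
      { toLinearMap := P (e x)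
        leibniz' := fun y z ↦ by
          rw [h3, ← lie_skew (P (e x) y) z]
          abel }
    obtain ⟨a, ha⟩ := LieDerivation.IsKilling.exists_eq_ad D
    exact ⟨a, fun y ↦ show D y = ⁅a, y⁆ by rw [← ha]; simp⟩
  choose φ hφ using hex
  have hlie : ∀ x y, φ ⁅x, y⁆ = ⁅φ x, φ y⁆ := fun x y ↦ hinj _ _ fun z ↦ by
    have := h2 (e x) (e y) z
    simp only [LinearEquiv.symm_apply_apply, hφ] at this
    rw [this, lie_lie]
  let Φ : g →ₗ⁅K⁆ n :=
    { toFun := φ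
      map_add' := fun x y ↦ hinj _ _ fun z ↦ by simp [← hφ]
      map_smul' := fun c x ↦ hinj _ _ fun z ↦ by simp [← hφ]
      map_lie' := hlie _ _ }
  refine ⟨Φ, { toLinearMap := (Φ : g →ₗ[K] n) + (e : g →ₗ[K] n), map_lie' := ?_ }, hφ, fun x ↦ rfl⟩
  intro x y
  change φ ⁅x, y⁆ + e ⁅x, y⁆ = ⁅φ x + e x, φ y + e y⁆
  have := h1 (e x) (e y)
  simp only [LinearEquiv.symm_apply_apply, hφ] at this
  rw [hlie, eq_add_of_sub_eq this.symm, ← lie_skew (φ y) (e x)]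
  simp only [add_lie, lie_add]
  abel

/-- Proposition 4.8: if `P` is a post-Lie algebra structure on `(g,n)` with `g` simple and
`n` semisimple, then `n` is simple and either `x·y = 0` for all `x,y` (and then
`[x,y] = {x,y}`), or `x·y = [x,y] = -{x,y}` for all `x,y`. -/
theorem postLie_simple_semisimple {g n : Type*}
    [LieRing g] [LieAlgebra ℂ g] [LieRing n] [LieAlgebra ℂ n]
    [FiniteDimensional ℂ n] (e : g ≃ₗ[ℂ] n)
    [LieAlgebra.IsSimple ℂ g] [LieAlgebra.IsSemisimple ℂ n]
    (P : n →ₗ[ℂ] n →ₗ[ℂ] n) (hP : IsPostLiePair e P) :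
    LieAlgebra.IsSimple ℂ n ∧
      (((∀ x y : n, P x y = 0) ∧
          (∀ x y : n, e ⁅e.symm x, e.symm y⁆ = ⁅x, y⁆)) ∨
       (∀ x y : n, P x y = e ⁅e.symm x, e.symm y⁆ ∧ P x y = -⁅x, y⁆)) := by
  have : FiniteDimensional ℂ g := e.symm.finiteDimensional
  have : Nontrivial g := LieAlgebra.IsSimple.nontrivial ℂ g
  have hrank : Module.finrank ℂ g = Module.finrank ℂ n := e.finrank_eq
  obtain ⟨φ, ψ, hφ, hψ⟩ := hP.exists_lieHom
  have hPφ : ∀ x y, P x y = ⁅φ (e.symm x), y⁆ := fun x y ↦ by rw [← hφ, e.apply_symm_apply]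
  have equiv_of_injective : ∀ f : g →ₗ⁅ℂ⁆ n, Function.Injective f →
      ∃ E : g ≃ₗ⁅ℂ⁆ n, ∀ x, E x = f x := fun f hf ↦
    ⟨LieEquiv.ofBijective f ⟨hf, (LinearMap.injective_iff_surjective_of_finrank_eq_finrank
      (f := (f : g →ₗ[ℂ] n)) hrank).1 hf⟩, fun _ ↦ rfl⟩
  rcases LieAlgebra.IsSimple.eq_zero_or_injective φ with hφ0 | hφi
  · have hψe : ∀ x, ψ x = e x := fun x ↦ by rw [hψ, hφ0, zero_add]
    obtain ⟨E, -⟩ := equiv_of_injective ψ fun x y h ↦ e.injective (by rw [← hψe, ← hψe, h])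
    refine ⟨.of_equiv E, .inl ⟨fun x y ↦ by rw [hPφ, hφ0, zero_lie], fun x y ↦ ?_⟩⟩
    rw [← hψe, LieHom.map_lie, hψe, hψe, e.apply_symm_apply, e.apply_symm_apply]
  obtain ⟨E, hE⟩ := equiv_of_injective φ hφi
  refine ⟨.of_equiv E, .inr ?_⟩
  rcases LieAlgebra.IsSimple.eq_zero_or_injective ψ with hψ0 | hψi
  · have hφe : ∀ x, φ x = -e x := fun x ↦ eq_neg_of_add_eq_zero_left (by rw [← hψ, hψ0])
    intro x y
    have hPneg : P x y = -⁅x, y⁆ := by rw [hPφ, hφe, e.apply_symm_apply, neg_lie]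
    refine ⟨?_, hPneg⟩
    have := φ.map_lie (e.symm x) (e.symm y)
    rw [hφe, hφe, hφe, e.apply_symm_apply, e.apply_symm_apply, neg_lie, lie_neg, neg_neg] at this
    rw [hPneg, ← this, neg_neg]
  · obtain ⟨x, hx, hfix⟩ := LieHom.exists_fixed_ne_zero_of_perfect
      (LieAlgebra.IsSimple.lie_top_top_eq_top ℂ g) (E.symm.toLieHom.comp ψ)
      (E.symm.injective.comp hψi)
    have h : ψ x = φ x := by
      rw [← hE]
      exact (LieEquiv.apply_symm_apply E (ψ x)).symm.trans (congrArg E hfix)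
    rw [hψ, add_eq_left] at h
    exact absurd (e.map_eq_zero_iff.1 h) hx
end
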